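/- arXiv:1401.6156 — 4 statements merged into one kernel-verified Lean document; each statement's English description precedes it below -/
import Mathlib

section
/- In the group algebra ℂ[S_n], the subalgebra generated by the Jucys–Murphy elements L_1, L_2, …, L_n coincides with the subalgebra generated by the union of the centers Z(ℂ[S_1]), Z(ℂ[S_2]), …, Z(ℂ[S_n]), where for each k the group algebra ℂ[S_k] is embedded in ℂ[S_n] via the subgroup S_k ⊆ S_n of permutations fixing k+1, …, n. -/
open MonoidAlgebra

/-- The `k`-th Jucys–Murphy element of `ℂ[Sₙ]` (0-indexed: `JM n k` corresponds to the
classical `L_{k+1} = Σ_{m < k+1} (m, k+1)`, so `JM n 0 = L₁ = 0`). -/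
noncomputable def JM (n : ℕ) (k : Fin n) : MonoidAlgebra ℂ (Equiv.Perm (Fin n)) :=
  ∑ m ∈ Finset.univ.filter (fun m : Fin n => m < k),
    MonoidAlgebra.of ℂ (Equiv.Perm (Fin n)) (Equiv.swap m k)

/-- The group algebra `ℂ[S_k]` inside `ℂ[S_n]`, where `S_k ⊆ S_n` is the subgroup of
permutations fixing the letters `k+1, …, n` (0-indexed: fixing all `j` with `j ≥ k`). -/
noncomputable def subGroupAlgebra (n k : ℕ) :
    Subalgebra ℂ (MonoidAlgebra ℂ (Equiv.Perm (Fin n))) :=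
  Algebra.adjoin ℂ
    {a | ∃ σ : Equiv.Perm (Fin n),
      (∀ j : Fin n, k ≤ (j : ℕ) → σ j = j) ∧
      a = MonoidAlgebra.of ℂ (Equiv.Perm (Fin n)) σ}

/-- The center `Z(ℂ[S_k])` of the group algebra `ℂ[S_k] ⊆ ℂ[Sₙ]`, as a set. -/
def centerSet (n k : ℕ) : Set (MonoidAlgebra ℂ (Equiv.Perm (Fin n))) :=
  {z | z ∈ subGroupAlgebra n k ∧ ∀ w ∈ subGroupAlgebra n k, z * w = w * z}


namespace GZ

open Equiv

/-- Permutations fixing all `j ≥ k`. -/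
def G (n k : ℕ) : Subgroup (Perm (Fin n)) where
  carrier := {σ | ∀ j : Fin n, k ≤ (j : ℕ) → σ j = j}
  mul_mem' := by
    intro a b ha hb j hj
    rw [Perm.mul_apply, hb j hj, ha j hj]
  one_mem' := by intro j _; rfl
  inv_mem' := by
    intro a ha j hj
    rw [Perm.inv_eq_iff_eq]
    exact (ha j hj).symm

theorem mem_G {n k : ℕ} {σ : Perm (Fin n)} :
    σ ∈ G n k ↔ ∀ j : Fin n, k ≤ (j : ℕ) → σ j = j := Iff.rfl

theorem G_lt {n k : ℕ} {σ : Perm (Fin n)} (h : σ ∈ G n k) (m : Fin n) :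
    (σ m : ℕ) < k ↔ (m : ℕ) < k := by
  constructor
  · intro hm
    by_contra hc
    rw [h m (not_lt.mp hc)] at hm
    exact hc hm
  · intro hm
    by_contra hc
    have h1 := h (σ m) (not_lt.mp hc)
    have h2 := σ.injective h1
    rw [h2] at hc
    exact hc hm

theorem G_mono {n k l : ℕ} (h : k ≤ l) : G n k ≤ G n l := fun _ hσ j hj => hσ j (h.trans hj)

theorem swap_mem_G {n k : ℕ} {a b : Fin n} (ha : (a : ℕ) < k) (hb : (b : ℕ) < k) :
    swap a b ∈ G n k := by
  intro j hj
  apply swap_apply_of_ne_of_ne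
  · rintro rfl; omega
  · rintro rfl; omega

noncomputable abbrev g {n : ℕ} (σ : Perm (Fin n)) : MonoidAlgebra ℂ (Perm (Fin n)) :=
  MonoidAlgebra.of ℂ (Perm (Fin n)) σ

theorem g_mul {n : ℕ} (σ τ : Perm (Fin n)) : g (σ * τ) = g σ * g τ := map_mul _ _ _

theorem g_inv_mul {n : ℕ} (σ : Perm (Fin n)) : g σ⁻¹ * g σ = 1 := by
  rw [← g_mul, inv_mul_cancel]; exact map_one _

theorem g_mul_inv {n : ℕ} (σ : Perm (Fin n)) : g σ * g σ⁻¹ = 1 := by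
  rw [← g_mul, mul_inv_cancel]; exact map_one _

open Classical in
/-- The sum of conjugates by `G n k`. -/
noncomputable def E (n k : ℕ) :
    MonoidAlgebra ℂ (Perm (Fin n)) →ₗ[ℂ] MonoidAlgebra ℂ (Perm (Fin n)) :=
  ∑ τ : G n k, (LinearMap.mulLeft ℂ (g (τ : Perm (Fin n)))) ∘ₗ
    (LinearMap.mulRight ℂ (g (τ : Perm (Fin n))⁻¹))

open Classical in
theorem E_apply (n k : ℕ) (a : MonoidAlgebra ℂ (Perm (Fin n))) :
    E n k a = ∑ τ : G n k, g (τ : Perm (Fin n)) * a * g (τ : Perm (Fin n))⁻¹ := by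
  simp [E, LinearMap.sum_apply, mul_assoc]

theorem E_conj {n k : ℕ} {σ : Perm (Fin n)} (h : σ ∈ G n k)
    (a : MonoidAlgebra ℂ (Perm (Fin n))) : E n k (g σ * a * g σ⁻¹) = E n k a := by
  classical
  rw [E_apply, E_apply]
  refine Fintype.sum_equiv (Equiv.mulRight (⟨σ, h⟩ : G n k)) _ _ ?_
  intro τ
  simp only [Equiv.coe_mulRight, Subgroup.coe_mul, mul_inv_rev, g_mul, mul_assoc]

theorem conj_E {n k : ℕ} {σ : Perm (Fin n)} (h : σ ∈ G n k)
    (a : MonoidAlgebra ℂ (Perm (Fin n))) : g σ * E n k a * g σ⁻¹ = E n k a := by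
  classical
  rw [E_apply, Finset.mul_sum, Finset.sum_mul]
  refine Fintype.sum_equiv (Equiv.mulLeft (⟨σ, h⟩ : G n k)) _ _ ?_
  intro τ
  simp only [Equiv.coe_mulLeft, Subgroup.coe_mul, mul_inv_rev, g_mul, mul_assoc]

/-- An invariant element is a multiple of its average. -/
theorem mem_of_E {n k : ℕ} (A : Subalgebra ℂ (MonoidAlgebra ℂ (Perm (Fin n))))
    (a : MonoidAlgebra ℂ (Perm (Fin n)))
    (hinv : ∀ σ ∈ G n k, g σ * a * g σ⁻¹ = a) (h : E n k a ∈ A) : a ∈ A := by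
  classical
  have h1 : E n k a = (Fintype.card (G n k) : ℂ) • a := by
    rw [E_apply, Finset.sum_congr rfl (fun (τ : G n k) _ => hinv τ τ.2)]
    simp [← Nat.cast_smul_eq_nsmul ℂ]
  have h2 : (Fintype.card (G n k) : ℂ) ≠ 0 := Nat.cast_ne_zero.mpr Fintype.card_ne_zero
  have h3 := A.smul_mem h ((Fintype.card (G n k) : ℂ)⁻¹)
  rwa [h1, smul_smul, inv_mul_cancel₀ h2, one_smul] at h3

theorem conj_swap {n : ℕ} (σ : Perm (Fin n)) (a b : Fin n) :
    g σ * g (swap a b) * g σ⁻¹ = g (swap (σ a) (σ b)) := by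
  rw [← g_mul, ← g_mul, Equiv.swap_apply_apply]

theorem conj_JM {n : ℕ} (k : Fin n) {σ : Perm (Fin n)} (h : σ ∈ G n k) :
    g σ * JM n k * g σ⁻¹ = JM n k := by
  unfold JM
  rw [Finset.mul_sum, Finset.sum_mul]
  refine Finset.sum_equiv σ ?_ ?_
  · intro m
    simp only [Finset.mem_filter, Finset.mem_univ, true_and, Fin.lt_def]
    exact (G_lt h m).symm
  · intro m _
    have := conj_swap σ m k
    rw [h k le_rfl] at this
    exact this

theorem E_mul_JM {n : ℕ} (k : Fin n) (a : MonoidAlgebra ℂ (Perm (Fin n))) :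
    E n k a * JM n k = E n k (a * JM n k) := by
  classical
  rw [E_apply, E_apply, Finset.sum_mul]
  refine Finset.sum_congr rfl fun τ _ => ?_
  have h := conj_JM k τ.2
  calc g (τ : Perm (Fin n)) * a * g (τ : Perm (Fin n))⁻¹ * JM n k
      = g (τ : Perm (Fin n)) * a * g (τ : Perm (Fin n))⁻¹ *
        (g (τ : Perm (Fin n)) * JM n k * g (τ : Perm (Fin n))⁻¹) := by rw [h]
    _ = g (τ : Perm (Fin n)) * a * (g (τ : Perm (Fin n))⁻¹ *
        g (τ : Perm (Fin n))) * JM n k * g (τ : Perm (Fin n))⁻¹ := by simp only [mul_assoc]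
    _ = _ := by rw [g_inv_mul]; simp only [mul_assoc, mul_one]

/-- The algebra generated by the Jucys–Murphy elements. -/
noncomputable abbrev A (n : ℕ) : Subalgebra ℂ (MonoidAlgebra ℂ (Perm (Fin n))) :=
  Algebra.adjoin ℂ {a | ∃ k : Fin n, a = JM n k}

theorem key {n : ℕ} (k : Fin n) (hk : ∀ σ ∈ G n k, E n k (g σ) ∈ A n) (N : ℕ) :
    ∀ σ ∈ G n (k + 1),
      (Finset.univ.filter (fun x : Fin n => x < k ∧ σ x ≠ x)).card = N →
      E n k (g σ) ∈ A n := by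
  induction N using Nat.strong_induction_on with
  | _ N ih =>
  intro σ hσ hN
  by_cases hfix : σ k = k
  · apply hk
    intro j hj
    rcases Nat.eq_or_lt_of_le hj with h | h
    · have : j = k := Fin.ext h.symm
      rw [this, hfix]
    · exact hσ j h
  set j := σ k with hj
  have hjk : j < k := by
    have := (G_lt hσ k).mpr (Nat.lt_succ_self _)
    rw [← hj] at this
    exact lt_of_le_of_ne (Fin.le_def.mpr (Nat.lt_succ_iff.mp this)) hfix
  set ρ := σ * swap j k with hρ
  have hsw : ∀ m : Fin n, m < k → swap m k ∈ G n (k + 1) := fun m hm =>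
    swap_mem_G (Nat.lt_succ_of_lt hm) (Nat.lt_succ_self _)
  have hρG : ρ ∈ G n (k + 1) := mul_mem hσ (hsw j hjk)
  have hρj : ρ j = j := by simp [hρ, hj]
  have hσρ : σ = ρ * swap j k := by simp [hρ, mul_assoc]
  -- size of ρ
  have hlt : (Finset.univ.filter (fun x : Fin n => x < k ∧ ρ x ≠ x)).card < N := by
    rw [← hN]
    apply Finset.card_lt_card
    refine (Finset.ssubset_iff_of_subset ?_).mpr ⟨j, ?_, ?_⟩
    · intro x
      simp only [Finset.mem_filter, Finset.mem_univ, true_and]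
      rintro ⟨hx, hx2⟩
      refine ⟨hx, ?_⟩
      have hxj : x ≠ j := by rintro rfl; exact hx2 hρj
      have : ρ x = σ x := by rw [hρ, Perm.mul_apply, swap_apply_of_ne_of_ne hxj hx.ne]
      rwa [← this]
    · simp only [Finset.mem_filter, Finset.mem_univ, true_and]
      refine ⟨hjk, fun h => ?_⟩
      have h2 : σ j = σ k := h.trans hj
      exact hjk.ne (σ.injective h2)
    · simp [hρj]
  have hEρ : E n k (g ρ) ∈ A n := ih _ hlt ρ hρG rfl
  have hprod : E n k (g ρ) * JM n k ∈ A n :=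
    mul_mem hEρ (Algebra.subset_adjoin ⟨k, rfl⟩)
  have hexp : E n k (g ρ) * JM n k =
      ∑ m ∈ Finset.univ.filter (fun m : Fin n => m < k), E n k (g (ρ * swap m k)) := by
    rw [E_mul_JM, JM, Finset.mul_sum, map_sum]
    exact Finset.sum_congr rfl fun m _ => by rw [g_mul ρ]
  rw [hexp, ← Finset.sum_filter_add_sum_filter_not _ (fun m => ρ m = m)] at hprod
  have hlow : ∑ m ∈ (Finset.univ.filter (fun m : Fin n => m < k)).filter (fun m => ¬ ρ m = m),
      E n k (g (ρ * swap m k)) ∈ A n := by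
    refine sum_mem fun m hm => ?_
    simp only [Finset.mem_filter, Finset.mem_univ, true_and] at hm
    refine ih _ (lt_of_le_of_lt (Finset.card_le_card ?_) hlt) _ (mul_mem hρG (hsw m hm.1)) rfl
    intro x
    simp only [Finset.mem_filter, Finset.mem_univ, true_and]
    rintro ⟨hx, hx2⟩
    refine ⟨hx, ?_⟩
    by_cases hxm : x = m
    · rw [hxm]; exact hm.2
    · rwa [Perm.mul_apply, swap_apply_of_ne_of_ne hxm hx.ne] at hx2
  have hhigh : ∀ m ∈ (Finset.univ.filter (fun m : Fin n => m < k)).filter (fun m => ρ m = m),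
      E n k (g (ρ * swap m k)) = E n k (g σ) := by
    intro m hm
    simp only [Finset.mem_filter, Finset.mem_univ, true_and] at hm
    have hc : swap j m ∈ G n k := swap_mem_G hjk hm.1
    rw [← E_conj hc (g (ρ * swap m k)), ← g_mul, ← g_mul]
    congr 2
    have h1 : swap j m * ρ = ρ * swap j m := by
      have := Equiv.swap_apply_apply ρ j m
      rw [hρj, hm.2] at this
      conv_lhs => rw [this]
      simp [mul_assoc]
    have h2 : swap j m * swap m k * (swap j m)⁻¹ = swap j k := by
      have := Equiv.swap_apply_apply (swap j m) m k
      rw [swap_apply_right, swap_apply_of_ne_of_ne hjk.ne' hm.1.ne'] at this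
      exact this.symm
    rw [hσρ, ← h2, ← mul_assoc, h1]
    simp only [mul_assoc]
  rw [Finset.sum_congr rfl hhigh, Finset.sum_const, ← Nat.cast_smul_eq_nsmul ℂ] at hprod
  have h3 := (A n).sub_mem hprod hlow
  rw [add_sub_cancel_right] at h3
  set c := ((Finset.univ.filter (fun m : Fin n => m < k)).filter (fun m => ρ m = m)).card with hc
  have hc0 : (c : ℂ) ≠ 0 := by
    rw [Nat.cast_ne_zero, hc]
    refine Finset.card_ne_zero_of_mem (a := j) ?_
    simp [hρj, hjk]
  have h4 := (A n).smul_mem h3 (c : ℂ)⁻¹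
  rwa [smul_smul, inv_mul_cancel₀ hc0, one_smul] at h4

theorem main {n : ℕ} (k : ℕ) (hkn : k ≤ n) : ∀ σ ∈ G n k, E n k (g σ) ∈ A n := by
  induction k with
  | zero =>
    intro σ hσ
    classical
    rw [E_apply]
    refine sum_mem fun τ _ => ?_
    have h1 : σ = 1 := Equiv.ext fun j => hσ j (Nat.zero_le _)
    rw [h1, ← g_mul, mul_one, g_mul_inv]
    exact one_mem _
  | succ k ih =>
    intro σ hσ
    have hk := key (⟨k, hkn⟩ : Fin n) (ih (Nat.le_of_succ_le hkn))
    apply mem_of_E (k := k)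
    · intro τ hτ
      exact conj_E (G_mono (Nat.le_succ k) hτ) _
    · classical
      rw [E_apply n (k + 1), map_sum]
      refine sum_mem fun τ _ => ?_
      rw [← g_mul, ← g_mul]
      exact hk _ _ (mul_mem (mul_mem τ.2 hσ) (inv_mem τ.2)) rfl

theorem E_sub {n : ℕ} (k : ℕ) (hkn : k ≤ n) (a : MonoidAlgebra ℂ (Perm (Fin n)))
    (ha : a ∈ subGroupAlgebra n k) : E n k a ∈ A n := by
  have hset : {a | ∃ σ : Equiv.Perm (Fin n),
      (∀ j : Fin n, k ≤ (j : ℕ) → σ j = j) ∧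
      a = MonoidAlgebra.of ℂ (Equiv.Perm (Fin n)) σ} =
      (((G n k).toSubmonoid.map (MonoidAlgebra.of ℂ (Equiv.Perm (Fin n))) :
        Submonoid (MonoidAlgebra ℂ (Perm (Fin n)))) : Set (MonoidAlgebra ℂ (Perm (Fin n)))) := by
    ext x
    constructor
    · rintro ⟨σ, h, rfl⟩
      exact ⟨σ, h, rfl⟩
    · rintro ⟨σ, h, rfl⟩
      exact ⟨σ, h, rfl⟩
  rw [subGroupAlgebra, hset, ← Subalgebra.mem_toSubmodule, Algebra.adjoin_eq_span,
    Submonoid.closure_eq] at ha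
  induction ha using Submodule.span_induction with
  | mem x hx =>
    obtain ⟨σ, h, rfl⟩ := hx
    exact main k hkn σ h
  | zero => rw [map_zero]; exact zero_mem _
  | add x y _ _ hx hy => rw [map_add]; exact add_mem hx hy
  | smul c x _ hx => rw [map_smul]; exact (A n).smul_mem hx c

theorem g_mem_sub {n k : ℕ} {σ : Perm (Fin n)} (h : σ ∈ G n k) : g σ ∈ subGroupAlgebra n k :=
  Algebra.subset_adjoin ⟨σ, h, rfl⟩

/-- Sum of all `swap a b` with `a, b < k`. -/
noncomputable def U (n k : ℕ) : MonoidAlgebra ℂ (Perm (Fin n)) :=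
  ∑ a ∈ Finset.univ.filter (fun m : Fin n => (m : ℕ) < k),
    ∑ b ∈ Finset.univ.filter (fun m : Fin n => (m : ℕ) < k), g (swap a b)

theorem conj_U {n k : ℕ} {σ : Perm (Fin n)} (h : σ ∈ G n k) :
    g σ * U n k * g σ⁻¹ = U n k := by
  unfold U
  rw [Finset.mul_sum, Finset.sum_mul]
  have hm : ∀ m : Fin n, m ∈ Finset.univ.filter (fun m : Fin n => (m : ℕ) < k) ↔
      σ m ∈ Finset.univ.filter (fun m : Fin n => (m : ℕ) < k) := by
    intro m
    simp only [Finset.mem_filter, Finset.mem_univ, true_and]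
    exact (G_lt h m).symm
  refine Finset.sum_equiv σ hm fun a _ => ?_
  rw [Finset.mul_sum, Finset.sum_mul]
  exact Finset.sum_equiv σ hm fun b _ => conj_swap σ a b

theorem U_mem {n k : ℕ} : U n k ∈ centerSet n k := by
  refine ⟨?_, ?_⟩
  · refine sum_mem fun a ha => sum_mem fun b hb => g_mem_sub ?_
    simp only [Finset.mem_filter, Finset.mem_univ, true_and] at ha hb
    exact swap_mem_G ha hb
  · intro w hw
    induction hw using Algebra.adjoin_induction with
    | mem x hx =>
      obtain ⟨σ, h, rfl⟩ := hx
      have h1 := conj_U (n := n) (k := k) (σ := σ) h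
      calc U n k * g σ = g σ * U n k * g σ⁻¹ * g σ := by rw [h1]
        _ = g σ * U n k := by rw [mul_assoc, g_inv_mul, mul_one]
    | algebraMap r => exact (Algebra.commutes r _).symm
    | add x y _ _ hx hy => rw [mul_add, add_mul, hx, hy]
    | mul x y _ _ hx hy => rw [← mul_assoc, hx, mul_assoc, hy, mul_assoc]

theorem U_succ {n : ℕ} (k : Fin n) : U n (k + 1) = U n k + (2 : ℂ) • JM n k + 1 := by
  classical
  have hf : Finset.univ.filter (fun m : Fin n => (m : ℕ) < k + 1) =
      insert k (Finset.univ.filter (fun m : Fin n => (m : ℕ) < k)) := by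
    ext m
    simp only [Finset.mem_filter, Finset.mem_univ, true_and, Finset.mem_insert, Fin.ext_iff]
    omega
  have hnot : k ∉ Finset.univ.filter (fun m : Fin n => (m : ℕ) < k) := by simp
  have hJ : JM n k = ∑ m ∈ Finset.univ.filter (fun m : Fin n => (m : ℕ) < k), g (swap m k) := rfl
  have hJ' : JM n k = ∑ m ∈ Finset.univ.filter (fun m : Fin n => (m : ℕ) < k), g (swap k m) := by
    rw [hJ]; exact Finset.sum_congr rfl fun m _ => by rw [swap_comm]
  have h1 : g (swap k k) = 1 := by rw [swap_self]; exact map_one _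
  rw [U, hf, Finset.sum_insert hnot, Finset.sum_insert hnot,
    Finset.sum_congr rfl (fun a _ => Finset.sum_insert hnot), Finset.sum_add_distrib, ← hJ, ← hJ',
    h1, two_smul, U]
  abel

end GZ

/-- The Gelfand–Zetlin subalgebra:  in `ℂ[Sₙ]`, the subalgebra generated by the
Jucys–Murphy elements `L₁, …, Lₙ` coincides with the subalgebra generated by the union
of the centers `Z(ℂ[S₁]), …, Z(ℂ[Sₙ])`. -/
theorem gz_subalgebra_eq (n : ℕ) :
    Algebra.adjoin ℂ {a | ∃ k : Fin n, a = JM n k} =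
      Algebra.adjoin ℂ (⋃ k ∈ Set.Icc 1 n, centerSet n k) := by
  apply le_antisymm
  · refine Algebra.adjoin_le ?_
    rintro _ ⟨k, rfl⟩
    have hU : ∀ l, l ≤ n → GZ.U n l ∈ Algebra.adjoin ℂ (⋃ k ∈ Set.Icc 1 n, centerSet n k) := by
      intro l hl
      rcases Nat.eq_zero_or_pos l with rfl | h0
      · have : GZ.U n 0 = 0 := by simp [GZ.U]
        rw [this]; exact zero_mem _
      · exact Algebra.subset_adjoin (Set.mem_biUnion (⟨h0, hl⟩ : l ∈ Set.Icc 1 n) GZ.U_mem)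
    have h := GZ.U_succ k
    have h2 : JM n k = (2 : ℂ)⁻¹ • (GZ.U n (k + 1) - GZ.U n k - 1) := by
      rw [h, eq_inv_smul_iff₀ two_ne_zero]
      abel
    rw [h2]
    exact Subalgebra.smul_mem _
      (sub_mem (sub_mem (hU _ k.2) (hU _ k.2.le)) (one_mem _)) _
  · refine Algebra.adjoin_le ?_
    intro z hz
    simp only [Set.mem_iUnion] at hz
    obtain ⟨k, hk, hz1, hz2⟩ := hz
    refine GZ.mem_of_E (k := k) _ z ?_ (GZ.E_sub k hk.2 z hz1)
    intro σ hσ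
    rw [← hz2 _ (GZ.g_mem_sub hσ), mul_assoc, GZ.g_mul_inv, mul_one]
end

section
/- A tuple (i_1, …, i_n) ∈ ℂ^n is the content vector of a standard λ-tableau for some partition λ of n if and only if the following three conditions hold: (i) i_1 = 0; (ii) for every 1 < k ≤ n, at least one of i_k − 1, i_k + 1 occurs among i_1, …, i_{k−1}; (iii) whenever i_k = i_m with k < m, both i_k − 1 and i_k + 1 occur among i_{k+1}, …, i_{m−1}. -/
/-- `T : Fin n → ℕ × ℕ` is a standard tableau of shape `λ` (a Young diagram with `n`
cells) if `T` is a bijection from `{0, …, n-1}` (0-indexed entries: `T k` is the box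
containing the entry `k+1`) onto the cells of `λ` such that entries increase from left
to right along rows and from top to bottom along columns; equivalently, whenever the box
of one entry is immediately to the right of, or immediately below, the box of another
entry, the former entry is larger.  Boxes are pairs `(r, s)` = (row, column). -/
def IsStandardTableau (μ : YoungDiagram) (n : ℕ) (T : Fin n → ℕ × ℕ) : Prop :=
  Function.Injective T ∧ Set.range T = (μ.cells : Set (ℕ × ℕ)) ∧
    ∀ j k : Fin n,
      (((T k).1 = (T j).1 ∧ (T k).2 = (T j).2 + 1) ∨
       ((T k).1 = (T j).1 + 1 ∧ (T k).2 = (T j).2)) → j < k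

/-- Number of occurrences of `x` among `c 0, …, c (k-1)`. -/
def occ (c : ℕ → ℤ) (k : ℕ) (x : ℤ) : ℕ := Nat.count (fun j => c j = x) k

lemma occ_zero (c : ℕ → ℤ) (x : ℤ) : occ c 0 x = 0 := by simp [occ]

lemma occ_succ (c : ℕ → ℤ) (k : ℕ) (x : ℤ) :
    occ c (k+1) x = occ c k x + if c k = x then 1 else 0 := by
  simp [occ, Nat.count_succ]

lemma occ_succ_self (c : ℕ → ℤ) (k : ℕ) (x : ℤ) (h : c k = x) :
    occ c (k+1) x = occ c k x + 1 := by
  simp [occ_succ, h]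

lemma occ_succ_ne (c : ℕ → ℤ) (k : ℕ) (x : ℤ) (h : c k ≠ x) :
    occ c (k+1) x = occ c k x := by
  simp [occ_succ, h]

lemma occ_mono (c : ℕ → ℤ) (x : ℤ) {a b : ℕ} (h : a ≤ b) : occ c a x ≤ occ c b x :=
  Nat.count_monotone _ h

lemma occ_lt (c : ℕ → ℤ) (x : ℤ) {a j b : ℕ} (h : a ≤ j) (h2 : j < b) (hj : c j = x) :
    occ c a x + 1 ≤ occ c b x := by
  have h3 := occ_mono c x h
  have h4 := occ_mono c x (Nat.succ_le_of_lt h2)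
  have h5 := occ_succ_self c j x hj
  simp only [Nat.succ_eq_add_one] at h4
  omega

lemma occ_exists (c : ℕ → ℤ) (x : ℤ) (d : ℕ) :
    ∀ k, d < occ c k x → ∃ j < k, c j = x ∧ occ c j x = d := by
  intro k
  induction k with
  | zero => intro h; simp [occ_zero] at h
  | succ k ih =>
    intro h
    by_cases h1 : d < occ c k x
    · obtain ⟨j, hj, h2⟩ := ih h1
      exact ⟨j, by omega, h2⟩
    · by_cases h2 : c k = x
      · rw [occ_succ_self c k x h2] at h
        exact ⟨k, by omega, h2, by omega⟩
      · rw [occ_succ_ne c k x h2] at h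
        omega

/-- Shape invariant: the numbers of occurrences are the diagonal lengths of a Young diagram. -/
def OccInv (c : ℕ → ℤ) (k : ℕ) : Prop :=
  ∀ x : ℤ, (0 ≤ x → occ c k (x+1) ≤ occ c k x ∧ occ c k x ≤ occ c k (x+1) + 1) ∧
    (x < 0 → occ c k x ≤ occ c k (x+1) ∧ occ c k (x+1) ≤ occ c k x + 1)

lemma occInv_of (c : ℕ → ℤ) (n : ℕ)
    (h1 : ∀ k < n, k = 0 → c k = 0)
    (h2 : ∀ k < n, 0 < k → ∃ m < k, c m = c k - 1 ∨ c m = c k + 1)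
    (h3 : ∀ k m, k < m → m < n → c k = c m →
      (∃ j, k < j ∧ j < m ∧ c j = c k - 1) ∧ (∃ j, k < j ∧ j < m ∧ c j = c k + 1)) :
    ∀ k ≤ n, OccInv c k := by
  intro k
  induction k using Nat.strong_induction_on with
  | _ k ih =>
  intro hk
  rcases k with _ | k
  · intro x; simp [occ_zero]
  have I0 := ih k (by omega) (by omega)
  obtain ⟨y, hy⟩ : ∃ y, c k = y := ⟨_, rfl⟩
  have A := I0 y
  have B := I0 (y-1)
  rw [sub_add_cancel] at B
  -- the key statement
  have key : (0 ≤ y → occ c k y = occ c k (y+1)) ∧ (0 < y → occ c k (y-1) = occ c k y + 1) ∧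
      (y < 0 → occ c k (y+1) = occ c k y + 1) ∧ (y ≤ 0 → occ c k (y-1) = occ c k y) := by
    by_cases hd : occ c k y = 0
    · rcases Nat.eq_zero_or_pos k with h0 | hpos
      · have := h1 k (by omega) h0
        have hy0 : y = 0 := by omega
        subst h0 hy0
        simp [occ_zero]
      · obtain ⟨m, hm, hm2⟩ := h2 k (by omega) hpos
        rw [hy] at hm2
        rcases hm2 with hm2 | hm2
        · have := occ_lt c _ (Nat.zero_le m) hm hm2
          omega
        · have := occ_lt c _ (Nat.zero_le m) hm hm2
          omega
    · obtain ⟨m, hm, hmy, hmd⟩ := occ_exists c y (occ c k y - 1) k (by omega)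
      obtain ⟨⟨j, hj1, hj2, hj3⟩, ⟨j', hj1', hj2', hj3'⟩⟩ :=
        h3 m k hm (by omega) (by rw [hmy, hy])
      rw [hmy] at hj3 hj3'
      have e1 := occ_lt c _ (Nat.succ_le_of_lt hj1) hj2 hj3
      have e2 := occ_lt c _ (Nat.succ_le_of_lt hj1') hj2' hj3'
      simp only [Nat.succ_eq_add_one] at e1 e2
      have Im := ih m (by omega) (by omega)
      have Im1 := ih (m+1) (by omega) (by omega)
      have A1 := Im y
      have B1 := Im (y-1)
      have A2 := Im1 y
      have B2 := Im1 (y-1)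
      rw [sub_add_cancel] at B1 B2
      rw [occ_succ_self c m y hmy] at A2 B2
      rw [occ_succ_ne c m (y-1) (by omega)] at B2 e1
      rw [occ_succ_ne c m (y+1) (by omega)] at A2 e2
      omega
  intro x
  have X := I0 x
  by_cases hx : x = y
  · subst hx
    rw [occ_succ_self c k x hy, occ_succ_ne c k (x+1) (by omega)]
    omega
  · by_cases hx' : x = y - 1
    · subst hx'
      rw [sub_add_cancel, occ_succ_self c k y hy, occ_succ_ne c k (y-1) (by omega)]
      omega
    · rw [occ_succ_ne c k x (by omega), occ_succ_ne c k (x+1) (by omega)]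
      exact X

/-- The box of the entry `k`. -/
def boxOf (c : ℕ → ℤ) (k : ℕ) : ℕ × ℕ :=
  (occ c k (c k) + (-(c k)).toNat, occ c k (c k) + (c k).toNat)

lemma boxOf_eq (c : ℕ → ℤ) (k r s : ℕ) (h : boxOf c k = (r, s)) :
    c k = (s : ℤ) - r ∧ occ c k (c k) = min r s := by
  simp only [boxOf, Prod.mk.injEq] at h
  omega

lemma boxOf_inj (c : ℕ → ℤ) (a b : ℕ) (h : boxOf c a = boxOf c b) : a = b := by
  obtain ⟨p1, p2⟩ := boxOf_eq c a _ _ h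
  obtain ⟨q1, q2⟩ := boxOf_eq c b _ _ rfl
  have hc : c a = c b := p1.trans q1.symm
  rcases lt_trichotomy a b with hl | he | hl
  · have := occ_lt c (c a) le_rfl hl rfl
    rw [hc] at this p2
    omega
  · exact he
  · have := occ_lt c (c b) le_rfl hl rfl
    rw [hc] at p2
    omega

lemma boxOf_find (c : ℕ → ℤ) (k r s : ℕ) (h : min r s < occ c k ((s : ℤ) - r)) :
    ∃ j < k, boxOf c j = (r, s) := by
  obtain ⟨j, hj, hj1, hj2⟩ := occ_exists c _ _ k h
  refine ⟨j, hj, ?_⟩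
  simp only [boxOf, hj1, hj2, Prod.mk.injEq]
  omega

lemma boxOf_left (c : ℕ → ℤ) (k r s : ℕ) (I : OccInv c (k+1)) (h : boxOf c k = (r, s+1)) :
    ∃ j < k, boxOf c j = (r, s) := by
  obtain ⟨p1, p2⟩ := boxOf_eq c k _ _ h
  apply boxOf_find
  have := I ((s:ℤ) - r)
  have e : (s:ℤ) - r + 1 = c k := by rw [p1]; push_cast; ring
  rw [e, occ_succ_self c k _ rfl, occ_succ_ne c k _ (by omega)] at this
  omega

lemma boxOf_up (c : ℕ → ℤ) (k r s : ℕ) (I : OccInv c (k+1)) (h : boxOf c k = (r+1, s)) :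
    ∃ j < k, boxOf c j = (r, s) := by
  obtain ⟨p1, p2⟩ := boxOf_eq c k _ _ h
  apply boxOf_find
  have := I (c k)
  have e : c k + 1 = (s:ℤ) - r := by rw [p1]; push_cast; ring
  rw [e, occ_succ_self c k _ rfl, occ_succ_ne c k _ (by omega)] at this
  omega

lemma backward_int (n : ℕ) (c : ℕ → ℤ)
    (h1 : ∀ k < n, k = 0 → c k = 0)
    (h2 : ∀ k < n, 0 < k → ∃ m < k, c m = c k - 1 ∨ c m = c k + 1)
    (h3 : ∀ k m, k < m → m < n → c k = c m →
      (∃ j, k < j ∧ j < m ∧ c j = c k - 1) ∧ (∃ j, k < j ∧ j < m ∧ c j = c k + 1)) :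
    ∃ (μ : YoungDiagram) (T : Fin n → ℕ × ℕ), μ.card = n ∧ IsStandardTableau μ n T ∧
        ∀ k : Fin n, c k = ((T k).2 : ℤ) - ((T k).1 : ℤ) := by
  have I := occInv_of c n h1 h2 h3
  have inj : Function.Injective (fun k : Fin n => boxOf c k) := by
    intro a b h
    exact Fin.ext (boxOf_inj c a b h)
  have left : ∀ (r s k : ℕ), k < n → boxOf c k = (r, s+1) → ∃ j < k, boxOf c j = (r, s) :=
    fun r s k hk h => boxOf_left c k r s (I _ (by omega)) h
  have up : ∀ (r s k : ℕ), k < n → boxOf c k = (r+1, s) → ∃ j < k, boxOf c j = (r, s) :=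
    fun r s k hk h => boxOf_up c k r s (I _ (by omega)) h
  have lower : ∀ (a b r s k : ℕ), k < n → boxOf c k = (r+a, s+b) →
      ∃ j < n, boxOf c j = (r, s) := by
    intro a
    induction a with
    | zero =>
      intro b
      induction b with
      | zero => intro r s k hk h; exact ⟨k, hk, h⟩
      | succ b ih =>
        intro r s k hk h
        obtain ⟨j, hj, hj'⟩ := left (r+0) (s+b) k hk h
        exact ih r s j (by omega) hj'
    | succ a ih =>
      intro b r s k hk h
      obtain ⟨j, hj, hj'⟩ := up (r+a) (s+b) k hk h
      exact ih b r s j (by omega) hj'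
  refine ⟨⟨Finset.univ.image (fun k : Fin n => boxOf c k), ?_⟩, fun k => boxOf c k, ?_,
    ⟨inj, by simp, ?_⟩, ?_⟩
  · rintro ⟨r', s'⟩ ⟨r, s⟩ hle hm
    simp only [Finset.coe_image, Finset.coe_univ, Set.image_univ, Set.mem_range] at hm ⊢
    obtain ⟨k, hk⟩ := hm
    rw [Prod.mk_le_mk] at hle
    obtain ⟨j, hj, hj'⟩ := lower (r'-r) (s'-s) r s k k.2 (by rw [hk]; congr 1 <;> omega)
    exact ⟨⟨j, hj⟩, hj'⟩
  · simp [YoungDiagram.card, Finset.card_image_of_injective _ inj]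
  · intro j k h
    have : ∃ j' < (k:ℕ), boxOf c j' = boxOf c j := by
      rcases h with ⟨ha, hb⟩ | ⟨ha, hb⟩
      · exact left _ _ k k.2 (Prod.ext ha hb)
      · exact up _ _ k k.2 (Prod.ext ha hb)
    obtain ⟨j', hj', e⟩ := this
    have := boxOf_inj c _ _ e
    rw [Fin.lt_def]
    omega
  · intro k
    exact (boxOf_eq c k _ _ rfl).1

lemma backward (n : ℕ) (i : Fin n → ℂ)
    (h1 : ∀ k : Fin n, (k : ℕ) = 0 → i k = 0)
    (h2 : ∀ k : Fin n, 0 < (k : ℕ) → ∃ m : Fin n, m < k ∧ (i m = i k - 1 ∨ i m = i k + 1))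
    (h3 : ∀ k m : Fin n, k < m → i k = i m →
          (∃ j : Fin n, k < j ∧ j < m ∧ i j = i k - 1) ∧
          (∃ j : Fin n, k < j ∧ j < m ∧ i j = i k + 1)) :
    ∃ (μ : YoungDiagram) (T : Fin n → ℕ × ℕ), μ.card = n ∧
        IsStandardTableau μ n T ∧
        ∀ k : Fin n, i k = ((T k).2 : ℂ) - ((T k).1 : ℂ) := by
  have hint : ∀ (k : ℕ) (hk : k < n), ∃ z : ℤ, i ⟨k, hk⟩ = z := by
    intro k
    induction k using Nat.strong_induction_on with
    | _ k ih =>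
    intro hk
    rcases Nat.eq_zero_or_pos k with h0 | hpos
    · exact ⟨0, by rw [h1 _ h0]; simp⟩
    · obtain ⟨m, hm, h⟩ := h2 ⟨k, hk⟩ hpos
      obtain ⟨z, hz⟩ := ih m hm m.2
      have hz' : i m = z := hz
      rw [hz'] at h
      rcases h with h | h
      · exact ⟨z + 1, by push_cast; rw [h]; ring⟩
      · exact ⟨z - 1, by push_cast; rw [h]; ring⟩
  have : ∃ c : ℕ → ℤ, ∀ k : Fin n, i k = c k := by
    choose f hf using hint
    refine ⟨fun k => if hk : k < n then f k hk else 0, fun k => ?_⟩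
    simp [hf k k.2]
  obtain ⟨c, hc⟩ := this
  simp only [hc] at h1 h2 h3 ⊢
  norm_cast at h1 h2 h3
  obtain ⟨μ, T, a, b, d⟩ := backward_int n c (fun k hk => h1 ⟨k, hk⟩)
    (fun k hk h => by
      obtain ⟨m, hm, h⟩ := h2 ⟨k, hk⟩ h
      exact ⟨m, hm, h⟩)
    (fun k m hkm hm e => by
      obtain ⟨⟨j, a, b, d⟩, ⟨j', a', b', d'⟩⟩ := h3 ⟨k, by omega⟩ ⟨m, hm⟩ hkm e
      exact ⟨⟨j, a, b, d⟩, ⟨j', a', b', d'⟩⟩)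
  refine ⟨μ, T, a, b, fun k => ?_⟩
  rw [d k]; push_cast; rfl

lemma forward (n : ℕ) (i : Fin n → ℂ) (μ : YoungDiagram) (T : Fin n → ℕ × ℕ)
    (hT : IsStandardTableau μ n T)
    (hi : ∀ k : Fin n, i k = ((T k).2 : ℂ) - ((T k).1 : ℂ)) :
      ((∀ k : Fin n, (k : ℕ) = 0 → i k = 0) ∧
       (∀ k : Fin n, 0 < (k : ℕ) →
          ∃ m : Fin n, m < k ∧ (i m = i k - 1 ∨ i m = i k + 1)) ∧
       (∀ k m : Fin n, k < m → i k = i m →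
          (∃ j : Fin n, k < j ∧ j < m ∧ i j = i k - 1) ∧
          (∃ j : Fin n, k < j ∧ j < m ∧ i j = i k + 1))) := by
  obtain ⟨inj, hr, hs⟩ := hT
  have ex : ∀ (m : Fin n) (r s : ℕ), r ≤ (T m).1 → s ≤ (T m).2 → ∃ j, T j = (r, s) := by
    intro m r s h1 h2
    have : (r, s) ∈ Set.range T := by
      rw [hr]
      refine μ.isLowerSet (a := T m) (Prod.mk_le_mk.2 ⟨h1, h2⟩) ?_
      rw [← hr]; exact ⟨m, rfl⟩
    exact this
  have right : ∀ (j k : Fin n) (r s : ℕ), T j = (r, s) → T k = (r, s+1) → j < k := by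
    intro j k r s h1 h2
    exact hs j k (Or.inl (by simp [h1, h2]))
  have down : ∀ (j k : Fin n) (r s : ℕ), T j = (r, s) → T k = (r+1, s) → j < k := by
    intro j k r s h1 h2
    exact hs j k (Or.inr (by simp [h1, h2]))
  have mono : ∀ (a b r s : ℕ) (j k : Fin n), T j = (r, s) → T k = (r+a, s+b) → j ≤ k := by
    intro a
    induction a with
    | zero =>
      intro b
      induction b with
      | zero => intro r s j k h1 h2; exact (inj (h1.trans h2.symm)).le
      | succ b ih =>
        intro r s j k h1 h2
        obtain ⟨l, hl⟩ := ex k (r+0) (s+b) (by simp [h2]) (by simp [h2])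
        exact (ih r s j l h1 hl).trans (right l k _ _ hl h2).le
    | succ a ih =>
      intro b r s j k h1 h2
      obtain ⟨l, hl⟩ := ex k (r+a) (s+b) (by simp [h2]) (by simp [h2])
      exact (ih b r s j l h1 hl).trans (down l k _ _ hl h2).le
  have mono' : ∀ j k : Fin n, (T j).1 ≤ (T k).1 → (T j).2 ≤ (T k).2 → j ≤ k := by
    intro j k h1 h2
    refine mono ((T k).1 - (T j).1) ((T k).2 - (T j).2) _ _ j k rfl (Prod.ext ?_ ?_) <;>
      simp <;> omega
  have zero : ∀ k : Fin n, (k : ℕ) = 0 → T k = (0, 0) := by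
    intro k hk
    obtain ⟨j, hj⟩ := ex k 0 0 (by simp) (by simp)
    have := mono' j k (by simp [hj]) (by simp [hj])
    have e : j = k := Fin.ext (by rw [Fin.le_def] at this; omega)
    rw [← e, hj]
  refine ⟨?_, ?_, ?_⟩
  · intro k hk
    simp [hi, zero k hk]
  · intro k hk
    have hne : T k ≠ (0, 0) := by
      intro h
      have := inj (h.trans (zero ⟨0, by omega⟩ rfl).symm)
      rw [this] at hk
      simp at hk
    obtain ⟨⟨r, s⟩, hrs⟩ : ∃ p, T k = p := ⟨_, rfl⟩
    rw [hrs] at hne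
    rcases r with _ | r
    · rcases s with _ | s
      · exact absurd rfl hne
      · obtain ⟨j, hj⟩ := ex k 0 s (by simp) (by simp [hrs])
        exact ⟨j, right j k _ _ hj hrs, Or.inl (by simp [hi, hj, hrs])⟩
    · obtain ⟨j, hj⟩ := ex k r s (by simp [hrs]) (by simp [hrs])
      exact ⟨j, down j k _ _ hj hrs, Or.inr (by simp [hi, hj, hrs]; ring)⟩
  · intro k m hkm he
    rw [hi, hi] at he
    have he' : ((T k).2 : ℤ) - (T k).1 = (T m).2 - (T m).1 := by exact_mod_cast he
    have hlt : (T k).1 < (T m).1 := by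
      by_contra hcon
      exact absurd (mono' m k (by omega) (by omega)) (not_le.2 hkm)
    have hlt2 : (T k).2 < (T m).2 := by omega
    constructor
    · obtain ⟨j, hj⟩ := ex m ((T k).1 + 1) (T k).2 (by omega) (by omega)
      refine ⟨j, down k j _ _ rfl hj, lt_of_le_of_ne (mono' j m ?_ ?_) ?_, ?_⟩
      · rw [hj]; exact hlt
      · rw [hj]; exact hlt2.le
      · rintro rfl
        rw [hj] at hlt2; simp at hlt2
      · simp only [hi, hj]; push_cast; ring
    · obtain ⟨j, hj⟩ := ex m (T k).1 ((T k).2 + 1) (by omega) (by omega)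
      refine ⟨j, right k j _ _ rfl hj, lt_of_le_of_ne (mono' j m ?_ ?_) ?_, ?_⟩
      · rw [hj]; exact hlt.le
      · rw [hj]; exact hlt2
      · rintro rfl
        rw [hj] at hlt; simp at hlt
      · simp only [hi, hj]; push_cast; ring


/-- A tuple `(i₁, …, iₙ) ∈ ℂⁿ` is the content vector of a standard `λ`-tableau for some
partition `λ` of `n` (the content of the box `(r, s)` being `s − r`) if and only if:
(i) `i₁ = 0`; (ii) for every `k > 1`, one of `i_k − 1`, `i_k + 1` occurs among
`i₁, …, i_{k−1}`; (iii) whenever `i_k = i_m` with `k < m`, both `i_k − 1` and `i_k + 1`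
occur among `i_{k+1}, …, i_{m−1}`. -/
theorem content_vectors_of_standard_tableaux (n : ℕ) (i : Fin n → ℂ) :
    (∃ (μ : YoungDiagram) (T : Fin n → ℕ × ℕ), μ.card = n ∧
        IsStandardTableau μ n T ∧
        ∀ k : Fin n, i k = ((T k).2 : ℂ) - ((T k).1 : ℂ)) ↔
      ((∀ k : Fin n, (k : ℕ) = 0 → i k = 0) ∧
       (∀ k : Fin n, 0 < (k : ℕ) →
          ∃ m : Fin n, m < k ∧ (i m = i k - 1 ∨ i m = i k + 1)) ∧
       (∀ k m : Fin n, k < m → i k = i m →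
          (∃ j : Fin n, k < j ∧ j < m ∧ i j = i k - 1) ∧
          (∃ j : Fin n, k < j ∧ j < m ∧ i j = i k + 1))) := by
  constructor
  · rintro ⟨μ, T, _, hT, hi⟩
    exact forward n i μ T hT hi
  · rintro ⟨h1, h2, h3⟩
    exact backward n i h1 h2 h3
end

section
/- (Young's Orthogonal Form) For each partition λ of n, the orthogonal-form formulas define a representation of S_n on the complex vector space V^λ with basis indexed by the standard λ-tableaux (i.e. the images of the simple transpositions satisfy the Coxeter relations of S_n); this representation V^λ is irreducible; for distinct partitions λ ≠ μ of n the representations V^λ and V^μ are not isomorphic; and every irreducible complex representation of S_n is isomorphic to V^λ for some partition λ of n. -/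
/-- The complex vector space `V^μ` with basis indexed by the standard `μ`-tableaux. -/
abbrev YoungSpace (μ : YoungDiagram) (n : ℕ) : Type :=
  {T : Fin n → ℕ × ℕ // IsStandardTableau μ n T} → ℂ

/-- The coefficient `ρ = 1/(cont T_{q} − cont T_{p})` featuring in Young's orthogonal
form, where `cont (r, s) = s − r` (here `p`, `q` are 0-indexed entry positions). -/
noncomputable def rhoCoef {n : ℕ} (p q : Fin n) (T : Fin n → ℕ × ℕ) : ℝ :=
  ((((T q).2 : ℝ) - ((T q).1 : ℝ)) - (((T p).2 : ℝ) - ((T p).1 : ℝ)))⁻¹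

open scoped Classical in
/-- The operator of Young's orthogonal form attached to the simple transposition
swapping the (0-indexed) entries `p` and `q = p + 1`:  on the basis vector `w_T` it acts
by `w_T ↦ ρ w_T + √(1 − ρ²) w_{s T}` where `ρ = 1/(cont T_{q} − cont T_{p})` and `s T`
is `T` with the entries `p, q` swapped (the second term being omitted when `s T` is not
standard, in which case `√(1 − ρ²) = 0`). -/
noncomputable def youngOp (μ : YoungDiagram) (n : ℕ) (p q : Fin n) :
    Module.End ℂ (YoungSpace μ n) where
  toFun f := fun S =>
    (rhoCoef p q S.val : ℂ) * f S +
      ((Real.sqrt (1 - (rhoCoef p q S.val) ^ 2) : ℝ) : ℂ) *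
        (if h : IsStandardTableau μ n (S.val ∘ Equiv.swap p q) then
          f ⟨S.val ∘ Equiv.swap p q, h⟩ else 0)
  map_add' f g := by
    funext S
    by_cases h : IsStandardTableau μ n (S.val ∘ Equiv.swap p q) <;>
      simp [h] <;> ring
  map_smul' c f := by
    funext S
    by_cases h : IsStandardTableau μ n (S.val ∘ Equiv.swap p q) <;>
      simp [h] <;> ring

/-- A representation of `Sₙ` on `V^μ` is "the" Young orthogonal form representation if
every adjacent transposition `(p, p+1)` acts by the orthogonal-form operator. -/
def IsYoungOrthogonalRep (μ : YoungDiagram) (n : ℕ)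
    (ρ : Representation ℂ (Equiv.Perm (Fin n)) (YoungSpace μ n)) : Prop :=
  ∀ p q : Fin n, (q : ℕ) = (p : ℕ) + 1 → ρ (Equiv.swap p q) = youngOp μ n p q

/-- A representation `ρ` of `G` on `V` is irreducible if `V ≠ 0` and the only
`G`-invariant subspaces of `V` are `0` and `V`. -/
def RepIsIrreducible {k : Type*} [Field k] {G : Type*} [Group G]
    {V : Type*} [AddCommGroup V] [Module k V] (ρ : Representation k G V) : Prop :=
  (∃ v : V, v ≠ 0) ∧
    ∀ p : Submodule k V, (∀ (g : G) (v : V), v ∈ p → ρ g v ∈ p) → p = ⊥ ∨ p = ⊤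

namespace YoungProof

/-- Standard tableaux are monotone: boxes weakly north-west come earlier. -/
lemma std_mono {μ : YoungDiagram} {n : ℕ} {T : Fin n → ℕ × ℕ} (hT : IsStandardTableau μ n T) :
    ∀ (d : ℕ) (j k : Fin n), (T j).1 ≤ (T k).1 → (T j).2 ≤ (T k).2 →
      ((T k).1 - (T j).1) + ((T k).2 - (T j).2) = d → j ≤ k := by
  obtain ⟨hinj, hrange, hstd⟩ := hT
  have hmem : ∀ k, T k ∈ μ := fun k => by
    have : T k ∈ Set.range T := ⟨k, rfl⟩
    rw [hrange] at this
    exact this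
  have hsurj : ∀ c, c ∈ μ → ∃ i, T i = c := fun c hc => by
    have : c ∈ Set.range T := by rw [hrange]; exact hc
    exact this
  intro d
  induction d with
  | zero =>
    intro j k h1 h2 h3
    have : T j = T k := Prod.ext (by omega) (by omega)
    exact le_of_eq (hinj this)
  | succ d ih =>
    intro j k h1 h2 h3
    by_cases hlt : (T j).1 < (T k).1
    · have hc : ((T k).1 - 1, (T k).2) ∈ μ :=
        μ.up_left_mem (Nat.sub_le _ _) (le_refl (T k).2) (hmem k)
      obtain ⟨i, hi⟩ := hsurj _ hc
      have hik : i < k := hstd i k (Or.inr (by rw [hi]; constructor <;> simp; omega))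
      have hji : j ≤ i := ih j i (by rw [hi]; simp; omega) (by rw [hi]; exact h2)
        (by rw [hi]; simp; omega)
      exact hji.trans hik.le
    · have hlt2 : (T j).2 < (T k).2 := by omega
      have hc : ((T k).1, (T k).2 - 1) ∈ μ :=
        μ.up_left_mem (le_refl (T k).1) (Nat.sub_le _ _) (hmem k)
      obtain ⟨i, hi⟩ := hsurj _ hc
      have hik : i < k := hstd i k (Or.inl (by rw [hi]; constructor <;> simp; omega))
      have hji : j ≤ i := ih j i (by rw [hi]; exact h1) (by rw [hi]; simp; omega)
        (by rw [hi]; simp; omega)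
      exact hji.trans hik.le

/-- the content of a box -/
def cont (c : ℕ × ℕ) : ℤ := (c.2 : ℤ) - (c.1 : ℤ)

lemma std_mem {μ : YoungDiagram} {n : ℕ} {T : Fin n → ℕ × ℕ} (hT : IsStandardTableau μ n T)
    (k : Fin n) : T k ∈ μ := by
  have : T k ∈ Set.range T := ⟨k, rfl⟩
  rw [hT.2.1] at this
  exact this

lemma std_surj {μ : YoungDiagram} {n : ℕ} {T : Fin n → ℕ × ℕ} (hT : IsStandardTableau μ n T)
    (c : ℕ × ℕ) (hc : c ∈ μ) : ∃ i, T i = c := by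
  have : c ∈ Set.range T := by rw [hT.2.1]; exact hc
  exact this

lemma std_le {μ : YoungDiagram} {n : ℕ} {T : Fin n → ℕ × ℕ} (hT : IsStandardTableau μ n T)
    (j k : Fin n) (h1 : (T j).1 ≤ (T k).1) (h2 : (T j).2 ≤ (T k).2) : j ≤ k :=
  std_mono hT _ j k h1 h2 rfl

lemma std_lt {μ : YoungDiagram} {n : ℕ} {T : Fin n → ℕ × ℕ} (hT : IsStandardTableau μ n T)
    (j k : Fin n) (h1 : (T j).1 ≤ (T k).1) (h2 : (T j).2 ≤ (T k).2) (h : T j ≠ T k) : j < k :=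
  lt_of_le_of_ne (std_le hT j k h1 h2) (fun e => h (by rw [e]))

/-- Entries with equal content differ by at least three. -/
lemma cont_eq_far_aux {μ : YoungDiagram} {n : ℕ} {T : Fin n → ℕ × ℕ}
    (hT : IsStandardTableau μ n T) (j k : Fin n) (hc : cont (T j) = cont (T k))
    (hlt : (T j).1 < (T k).1) : (j : ℕ) + 3 ≤ k := by
  unfold cont at hc
  obtain ⟨a, ha⟩ := std_surj hT ((T j).1 + 1, (T j).2)
    (μ.up_left_mem (show (T j).1 + 1 ≤ (T k).1 by omega) (show (T j).2 ≤ (T k).2 by omega)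
      (std_mem hT k))
  obtain ⟨b, hb⟩ := std_surj hT ((T j).1, (T j).2 + 1)
    (μ.up_left_mem (show (T j).1 ≤ (T k).1 by omega) (show (T j).2 + 1 ≤ (T k).2 by omega)
      (std_mem hT k))
  have h1 : j < a := std_lt hT j a (by rw [ha]; simp) (by rw [ha])
    (by rw [ha]; intro h; have := congrArg Prod.fst h; simp at this)
  have h2 : j < b := std_lt hT j b (by rw [hb]) (by rw [hb]; simp)
    (by rw [hb]; intro h; have := congrArg Prod.snd h; simp at this)
  have h3 : a < k := std_lt hT a k (by rw [ha]; simp; omega) (by rw [ha]; simp; omega)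
    (by rw [ha]; intro h; have := congrArg Prod.snd h; simp at this; omega)
  have h4 : b < k := std_lt hT b k (by rw [hb]; simp; omega) (by rw [hb]; simp; omega)
    (by rw [hb]; intro h; have := congrArg Prod.fst h; simp at this; omega)
  have h5 : a ≠ b := by
    rintro rfl
    rw [ha] at hb
    have := congrArg Prod.fst hb; simp at this
  have h5' : (a : ℕ) ≠ b := fun h => h5 (Fin.ext h)
  simp only [Fin.lt_def] at *
  omega

lemma cont_ne {μ : YoungDiagram} {n : ℕ} {T : Fin n → ℕ × ℕ}
    (hT : IsStandardTableau μ n T) (j k : Fin n) (hjk : (j : ℕ) < k) (h3 : (k : ℕ) < j + 3) :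
    cont (T j) ≠ cont (T k) := by
  intro hc
  rcases lt_trichotomy (T j).1 (T k).1 with h | h | h
  · have := cont_eq_far_aux hT j k hc h; omega
  · have : T j = T k := Prod.ext h (by unfold cont at hc; omega)
    have := hT.1 this
    rw [this] at hjk; omega
  · have := cont_eq_far_aux hT k j hc.symm h; omega

/-- The content vector determines the tableau. -/
lemma eq_of_cont_eq {μ ν : YoungDiagram} {n : ℕ} {S T : Fin n → ℕ × ℕ}
    (hS : IsStandardTableau μ n S) (hT : IsStandardTableau ν n T)
    (h : ∀ k, cont (S k) = cont (T k)) : S = T := by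
  have key : ∀ (m : ℕ) (k : Fin n), (k : ℕ) = m → S k = T k := by
    intro m
    induction m using Nat.strong_induction_on with
    | _ m ih =>
      intro k hk
      have hc := h k
      unfold cont at hc
      rcases lt_trichotomy (S k).1 (T k).1 with hlt | heq | hlt
      · exfalso
        obtain ⟨i, hi⟩ := std_surj hT (S k) (ν.up_left_mem (show (S k).1 ≤ (T k).1 by omega)
          (show (S k).2 ≤ (T k).2 by omega) (std_mem hT k))
        have hik : i < k := std_lt hT i k (by rw [hi]; omega) (by rw [hi]; omega)
          (by rw [hi]; intro h; rw [h] at hlt; omega)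
        have := ih i (by rw [← hk]; exact hik) i rfl
        rw [hi] at this
        exact absurd (hS.1 this) (ne_of_lt hik)
      · exact Prod.ext heq (by omega)
      · exfalso
        obtain ⟨i, hi⟩ := std_surj hS (T k) (μ.up_left_mem (show (T k).1 ≤ (S k).1 by omega)
          (show (T k).2 ≤ (S k).2 by omega) (std_mem hS k))
        have hik : i < k := std_lt hS i k (by rw [hi]; omega) (by rw [hi]; omega)
          (by rw [hi]; intro h; rw [h] at hlt; omega)
        have := ih i (by rw [← hk]; exact hik) i rfl
        rw [hi] at this
        exact absurd (hT.1 this.symm) (ne_of_lt hik)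
  funext k
  exact key k k rfl

/-- The first entry sits in the corner. -/
lemma std_zero {μ : YoungDiagram} {n : ℕ} {T : Fin n → ℕ × ℕ} (hT : IsStandardTableau μ n T)
    (k : Fin n) (hk : (k : ℕ) = 0) : cont (T k) = 0 := by
  obtain ⟨i, hi⟩ := std_surj hT (0, 0) (μ.up_left_mem (Nat.zero_le (T k).1)
    (Nat.zero_le (T k).2) (std_mem hT k))
  have : i ≤ k := std_le hT i k (by rw [hi]; simp) (by rw [hi]; simp)
  have : i = k := Fin.ext (by simp only [Fin.le_def] at this; omega)
  rw [← this, hi]; rfl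

/-- Swapping consecutive entries in non-adjacent boxes gives a standard tableau. -/
lemma std_swap_of {μ : YoungDiagram} {n : ℕ} {T : Fin n → ℕ × ℕ} (hT : IsStandardTableau μ n T)
    (p q : Fin n) (hpq : (q : ℕ) = p + 1)
    (hna : ¬ (((T q).1 = (T p).1 ∧ (T q).2 = (T p).2 + 1) ∨
       ((T q).1 = (T p).1 + 1 ∧ (T q).2 = (T p).2))) :
    IsStandardTableau μ n (T ∘ Equiv.swap p q) := by
  refine ⟨hT.1.comp (Equiv.injective _), ?_, ?_⟩
  · rw [(Equiv.swap p q).surjective.range_comp]; exact hT.2.1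
  · intro j k h
    have h1 := hT.2.2 _ _ h
    by_contra hlt
    have hne : ¬ (Equiv.swap p q j = p ∧ Equiv.swap p q k = q) := by
      rintro ⟨e1, e2⟩
      simp only [Function.comp, e1, e2] at h
      exact hna h
    simp only [Equiv.swap_apply_def] at h1 hne
    simp only [Fin.ext_iff, Fin.lt_def] at *
    split_ifs at h1 hne <;> simp_all <;> omega

/-- If swapping two consecutive entries is not standard, then the boxes are adjacent. -/
lemma cont_of_not_swap {μ : YoungDiagram} {n : ℕ} {T : Fin n → ℕ × ℕ}
    (hT : IsStandardTableau μ n T)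
    (p q : Fin n) (hpq : (q : ℕ) = p + 1)
    (h : ¬ IsStandardTableau μ n (T ∘ Equiv.swap p q)) :
    cont (T q) - cont (T p) = 1 ∨ cont (T q) - cont (T p) = -1 := by
  by_contra hc
  refine h (std_swap_of hT p q hpq ?_)
  rintro (⟨h1, h2⟩ | ⟨h1, h2⟩)
  · apply hc; left; unfold cont; omega
  · apply hc; right; unfold cont; omega

/-- If swapping two consecutive entries is standard, the contents differ by at least two. -/
lemma cont_of_swap {μ : YoungDiagram} {n : ℕ} {T : Fin n → ℕ × ℕ}
    (hT : IsStandardTableau μ n T)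
    (p q : Fin n) (hpq : (q : ℕ) = p + 1)
    (h : IsStandardTableau μ n (T ∘ Equiv.swap p q)) :
    cont (T q) - cont (T p) ≠ 1 ∧ cont (T q) - cont (T p) ≠ -1 := by
  have hlt : p < q := by rw [Fin.lt_def]; omega
  have hsp : (T ∘ Equiv.swap p q) q = T p := by simp
  have hsq : (T ∘ Equiv.swap p q) p = T q := by simp
  have A : ¬ ((T p).1 ≤ (T q).1 ∧ (T p).2 ≤ (T q).2) := by
    rintro ⟨h1, h2⟩
    have := std_le h q p (by rw [hsp, hsq]; exact h1) (by rw [hsp, hsq]; exact h2)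
    exact absurd this (not_le.2 hlt)
  have B : ¬ ((T q).1 ≤ (T p).1 ∧ (T q).2 ≤ (T p).2) := by
    rintro ⟨h1, h2⟩
    have := std_le hT q p h1 h2
    exact absurd this (not_le.2 hlt)
  unfold cont
  constructor <;> intro h <;> omega

lemma rho_eq {n : ℕ} (p q : Fin n) (T : Fin n → ℕ × ℕ) :
    rhoCoef p q T = (((cont (T q) - cont (T p) : ℤ) : ℝ))⁻¹ := by
  unfold rhoCoef cont; push_cast; rfl

lemma rho_sq_le {n : ℕ} (p q : Fin n) (T : Fin n → ℕ × ℕ) : (rhoCoef p q T) ^ 2 ≤ 1 := by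
  rw [rho_eq]
  generalize cont (T q) - cont (T p) = d
  by_cases hd : d = 0
  · simp [hd]
  · have : (1 : ℝ) ≤ (d : ℝ) ^ 2 := by
      have : (1 : ℤ) ≤ d ^ 2 := by
        have := sq_nonneg d
        have := pow_ne_zero 2 hd
        omega
      exact_mod_cast this
    rw [inv_pow]
    exact inv_le_one_of_one_le₀ this

/-- the off-diagonal coefficient -/
noncomputable def rc {n : ℕ} (p q : Fin n) (T : Fin n → ℕ × ℕ) : ℂ :=
  ((Real.sqrt (1 - (rhoCoef p q T) ^ 2) : ℝ) : ℂ)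

lemma rc_sq {n : ℕ} (p q : Fin n) (T : Fin n → ℕ × ℕ) :
    rc p q T * rc p q T = 1 - (rhoCoef p q T : ℂ) ^ 2 := by
  unfold rc
  rw [← Complex.ofReal_mul, Real.mul_self_sqrt (by linarith [rho_sq_le p q T])]
  push_cast; rfl

/-- The formal operator on functions on all fillings. -/
noncomputable def fop {n : ℕ} (p q : Fin n) (f : (Fin n → ℕ × ℕ) → ℂ) :
    (Fin n → ℕ × ℕ) → ℂ :=
  fun S => (rhoCoef p q S : ℂ) * f S + rc p q S * f (S ∘ Equiv.swap p q)

/-- restriction to standard tableaux -/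
def res (μ : YoungDiagram) {n : ℕ} (f : (Fin n → ℕ × ℕ) → ℂ) : YoungSpace μ n :=
  fun S => f S.val

lemma rc_zero {μ : YoungDiagram} {n : ℕ} {T : Fin n → ℕ × ℕ}
    (hT : IsStandardTableau μ n T)
    (p q : Fin n) (hpq : (q : ℕ) = p + 1)
    (h : ¬ IsStandardTableau μ n (T ∘ Equiv.swap p q)) : rc p q T = 0 := by
  unfold rc
  rw [rho_eq]
  rcases cont_of_not_swap hT p q hpq h with h | h <;> rw [h] <;> simp

lemma youngOp_res (μ : YoungDiagram) {n : ℕ} (p q : Fin n) (hpq : (q : ℕ) = p + 1)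
    (f : (Fin n → ℕ × ℕ) → ℂ) : youngOp μ n p q (res μ f) = res μ (fop p q f) := by
  funext S
  by_cases h : IsStandardTableau μ n (S.val ∘ Equiv.swap p q)
  · simp [youngOp, res, fop, h, rc]
  · have := rc_zero S.2 p q hpq h
    simp only [youngOp, res, fop, LinearMap.coe_mk, AddHom.coe_mk, h, dite_false, this]
    simp

lemma exists_res (μ : YoungDiagram) {n : ℕ} (f : YoungSpace μ n) :
    ∃ F : (Fin n → ℕ × ℕ) → ℂ, res μ F = f := by
  classical
  refine ⟨fun S => if h : IsStandardTableau μ n S then f ⟨S, h⟩ else 0, ?_⟩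
  funext S
  simp [res, S.2]

lemma rho_swap {n : ℕ} (p q : Fin n) (T : Fin n → ℕ × ℕ) :
    rhoCoef p q (T ∘ Equiv.swap p q) = - rhoCoef p q T := by
  simp only [rho_eq, Function.comp, Equiv.swap_apply_left, Equiv.swap_apply_right]
  rw [← inv_neg]; push_cast; ring_nf

lemma rc_swap {n : ℕ} (p q : Fin n) (T : Fin n → ℕ × ℕ) :
    rc p q (T ∘ Equiv.swap p q) = rc p q T := by
  unfold rc; rw [rho_swap, neg_sq]

lemma fop_sq {n : ℕ} (p q : Fin n) (f : (Fin n → ℕ × ℕ) → ℂ) : fop p q (fop p q f) = f := by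
  funext S
  have hS : (S ∘ Equiv.swap p q) ∘ Equiv.swap p q = S := by
    funext i; simp
  simp only [fop, rho_swap, rc_swap, hS]
  have := rc_sq p q S
  push_cast
  linear_combination (f S) * this

lemma rc_congr {n : ℕ} {p q p' q' : Fin n} {S S' : Fin n → ℕ × ℕ} (h1 : S p = S' p')
    (h2 : S q = S' q') : rc p q S = rc p' q' S' := by
  unfold rc rhoCoef; rw [h1, h2]

lemma rho_congr {n : ℕ} {p q p' q' : Fin n} {S S' : Fin n → ℕ × ℕ} (h1 : S p = S' p')
    (h2 : S q = S' q') : rhoCoef p q S = rhoCoef p' q' S' := by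
  unfold rhoCoef; rw [h1, h2]

lemma rho_neg {n : ℕ} (p q : Fin n) (T : Fin n → ℕ × ℕ) :
    rhoCoef q p T = - rhoCoef p q T := by
  simp only [rho_eq]
  rw [← inv_neg]; push_cast; ring_nf

lemma rc_neg {n : ℕ} (p q : Fin n) (T : Fin n → ℕ × ℕ) :
    rc q p T = rc p q T := by
  unfold rc; rw [rho_neg, neg_sq]

lemma fop_comm {n : ℕ} (p q p' q' : Fin n) (h1 : p ≠ p') (h2 : p ≠ q') (h3 : q ≠ p')
    (h4 : q ≠ q') (f : (Fin n → ℕ × ℕ) → ℂ) :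
    fop p q (fop p' q' f) = fop p' q' (fop p q f) := by
  funext S
  have e1 : ∀ S : Fin n → ℕ × ℕ, rhoCoef p q (S ∘ Equiv.swap p' q') = rhoCoef p q S := fun S =>
    rho_congr (by simp [Equiv.swap_apply_of_ne_of_ne h1 h2])
      (by simp [Equiv.swap_apply_of_ne_of_ne h3 h4])
  have e2 : ∀ S : Fin n → ℕ × ℕ, rc p q (S ∘ Equiv.swap p' q') = rc p q S := fun S =>
    rc_congr (by simp [Equiv.swap_apply_of_ne_of_ne h1 h2])
      (by simp [Equiv.swap_apply_of_ne_of_ne h3 h4])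
  have e3 : ∀ S : Fin n → ℕ × ℕ, rhoCoef p' q' (S ∘ Equiv.swap p q) = rhoCoef p' q' S := fun S =>
    rho_congr (by simp [Equiv.swap_apply_of_ne_of_ne h1.symm h3.symm])
      (by simp [Equiv.swap_apply_of_ne_of_ne h2.symm h4.symm])
  have e4 : ∀ S : Fin n → ℕ × ℕ, rc p' q' (S ∘ Equiv.swap p q) = rc p' q' S := fun S =>
    rc_congr (by simp [Equiv.swap_apply_of_ne_of_ne h1.symm h3.symm])
      (by simp [Equiv.swap_apply_of_ne_of_ne h2.symm h4.symm])
  have e5 : (S ∘ Equiv.swap p' q') ∘ Equiv.swap p q = (S ∘ Equiv.swap p q) ∘ Equiv.swap p' q' := by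
    funext i
    simp only [Function.comp]
    congr 1
    simp only [Equiv.swap_apply_def]
    split_ifs <;> simp_all
  simp only [fop, e1, e2, e3, e4, e5]
  ring

lemma fop_braid {n : ℕ} (p q r : Fin n) (hpq : p ≠ q) (hqr : q ≠ r) (hpr : p ≠ r)
    (S : Fin n → ℕ × ℕ) (h1 : cont (S p) ≠ cont (S q)) (h2 : cont (S q) ≠ cont (S r))
    (h3 : cont (S p) ≠ cont (S r)) (f : (Fin n → ℕ × ℕ) → ℂ) :
    fop p q (fop q r (fop p q f)) S = fop q r (fop p q (fop q r f)) S := by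
  have sp : ∀ S : Fin n → ℕ × ℕ, (S ∘ Equiv.swap p q) p = S q := fun S => by simp
  have sq : ∀ S : Fin n → ℕ × ℕ, (S ∘ Equiv.swap p q) q = S p := fun S => by simp
  have sr : ∀ S : Fin n → ℕ × ℕ, (S ∘ Equiv.swap p q) r = S r := fun S => by
    simp [Equiv.swap_apply_of_ne_of_ne hpr.symm hqr.symm]
  have tp : ∀ S : Fin n → ℕ × ℕ, (S ∘ Equiv.swap q r) p = S p := fun S => by
    simp [Equiv.swap_apply_of_ne_of_ne hpq hpr]
  have tq : ∀ S : Fin n → ℕ × ℕ, (S ∘ Equiv.swap q r) q = S r := fun S => by simp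
  have tr : ∀ S : Fin n → ℕ × ℕ, (S ∘ Equiv.swap q r) r = S q := fun S => by simp
  have a1 : ∀ S : Fin n → ℕ × ℕ, (S ∘ Equiv.swap p q) ∘ Equiv.swap p q = S := fun S => by
    funext i; simp
  have a2 : ∀ S : Fin n → ℕ × ℕ, (S ∘ Equiv.swap q r) ∘ Equiv.swap q r = S := fun S => by
    funext i; simp
  have a3 : ((S ∘ Equiv.swap p q) ∘ Equiv.swap q r) ∘ Equiv.swap p q =
      ((S ∘ Equiv.swap q r) ∘ Equiv.swap p q) ∘ Equiv.swap q r := by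
    funext i
    simp only [Function.comp]
    congr 1
    simp only [Equiv.swap_apply_def]
    split_ifs <;> simp_all
  -- the scalar data
  have b1 : rhoCoef p q (S ∘ Equiv.swap p q) = - rhoCoef p q S := rho_swap p q S
  have b2 : rhoCoef q r (S ∘ Equiv.swap p q) = rhoCoef p r S := rho_congr (sq S) (sr S)
  have b3 : rhoCoef p q ((S ∘ Equiv.swap p q) ∘ Equiv.swap q r) = rhoCoef q r S :=
    rho_congr (by rw [tp, sp]) (by rw [tq, sr])
  have b4 : rhoCoef p q (S ∘ Equiv.swap q r) = rhoCoef p r S := rho_congr (tp S) (tq S)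
  have b5 : rhoCoef q r (S ∘ Equiv.swap q r) = - rhoCoef q r S := rho_swap q r S
  have b6 : rhoCoef q r ((S ∘ Equiv.swap q r) ∘ Equiv.swap p q) = rhoCoef p q S :=
    rho_congr (by rw [sq, tp]) (by rw [sr, tr])
  have c1 : rc p q (S ∘ Equiv.swap p q) = rc p q S := rc_swap p q S
  have c2 : rc q r (S ∘ Equiv.swap p q) = rc p r S := rc_congr (sq S) (sr S)
  have c3 : rc p q ((S ∘ Equiv.swap p q) ∘ Equiv.swap q r) = rc q r S :=
    rc_congr (by rw [tp, sp]) (by rw [tq, sr])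
  have c4 : rc p q (S ∘ Equiv.swap q r) = rc p r S := rc_congr (tp S) (tq S)
  have c5 : rc q r (S ∘ Equiv.swap q r) = rc q r S := rc_swap q r S
  have c6 : rc q r ((S ∘ Equiv.swap q r) ∘ Equiv.swap p q) = rc p q S :=
    rc_congr (by rw [sq, tp]) (by rw [sr, tr])
  simp only [fop, b1, b2, b3, b4, b5, b6, c1, c2, c3, c4, c5, c6, a1, a2, a3]
  have r1 := rc_sq p q S
  have r2 := rc_sq q r S
  have key : (rhoCoef p q S : ℂ) * rhoCoef q r S =
      rhoCoef p r S * (rhoCoef p q S + rhoCoef q r S) := by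
    simp only [rho_eq]
    have d1 : ((cont (S q) - cont (S p) : ℤ) : ℂ) ≠ 0 := by
      exact_mod_cast sub_ne_zero.2 h1.symm
    have d2 : ((cont (S r) - cont (S q) : ℤ) : ℂ) ≠ 0 := by
      exact_mod_cast sub_ne_zero.2 h2.symm
    have d3 : ((cont (S r) - cont (S p) : ℤ) : ℂ) ≠ 0 := by
      exact_mod_cast sub_ne_zero.2 h3.symm
    push_cast at *
    field_simp
    ring
  push_cast
  generalize (rhoCoef p q S : ℂ) = x at *
  generalize (rhoCoef q r S : ℂ) = y at *
  generalize (rhoCoef p r S : ℂ) = z at *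
  generalize rc p q S = u at *
  generalize rc q r S = v at *
  generalize rc p r S = w at *
  generalize f S = f0
  generalize f (S ∘ Equiv.swap p q) = f1
  generalize f (S ∘ Equiv.swap q r) = f2
  generalize f ((S ∘ Equiv.swap p q) ∘ Equiv.swap q r) = f3
  generalize f ((S ∘ Equiv.swap q r) ∘ Equiv.swap p q) = f4
  linear_combination (f0 * z) * r1 - (f0 * z) * r2 + ((x - y) * f0 + u * f1 - v * f2) * key

section Presentation

variable {N : Type*} [Monoid N]

/-- the product `a k * a (k+1) * ... * a (k+d-1)` -/
def cyc (a : ℕ → N) : ℕ → ℕ → N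
  | _, 0 => 1
  | k, d + 1 => a k * cyc a (k + 1) d

lemma cyc_comm (a : ℕ → N) (m : ℕ)
    (h3 : ∀ i j, i + 1 < j → j ≤ m → a i * a j = a j * a i) (i : ℕ) :
    ∀ d k, i + 1 < k → k + d ≤ m + 1 → a i * cyc a k d = cyc a k d * a i := by
  intro d
  induction d with
  | zero => intro k _ _; simp [cyc]
  | succ d ih =>
    intro k h1 h2
    simp only [cyc]
    rw [← mul_assoc, h3 i k h1 (by omega), mul_assoc, ih (k + 1) (by omega) (by omega), mul_assoc]

lemma cyc_shift (a : ℕ → N) (m : ℕ)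
    (h2 : ∀ i, i + 1 ≤ m → a i * a (i + 1) * a i = a (i + 1) * a i * a (i + 1))
    (h3 : ∀ i j, i + 1 < j → j ≤ m → a i * a j = a j * a i) :
    ∀ d k i, k < i + 1 → i + 1 < k + d → k + d ≤ m + 1 →
      a (i + 1) * cyc a k d = cyc a k d * a i := by
  intro d
  induction d with
  | zero => intro k i h4 h5; omega
  | succ d ih =>
    intro k i h4 h5 h6
    by_cases hik : i = k
    · subst hik
      obtain ⟨d, rfl⟩ : ∃ e, d = e + 1 := ⟨d - 1, by omega⟩
      simp only [cyc]
      rw [← mul_assoc, ← mul_assoc, ← h2 i (by omega), mul_assoc, mul_assoc,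
        cyc_comm a m h3 i d (i + 1 + 1) (by omega) (by omega)]
      simp only [mul_assoc]
    · simp only [cyc]
      rw [← mul_assoc, ← h3 k (i + 1) (by omega) (by omega), mul_assoc,
        ih (k + 1) i (by omega) (by omega) (by omega), mul_assoc]

/-- the submonoid generated by the first `m` generators -/
def gen (a : ℕ → N) (m : ℕ) : Submonoid N := Submonoid.closure (a '' {i | i < m})

lemma gen_normal (a : ℕ → N) (m : ℕ)
    (h1 : ∀ i, i ≤ m → a i * a i = 1)
    (h2 : ∀ i, i + 1 ≤ m → a i * a (i + 1) * a i = a (i + 1) * a i * a (i + 1))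
    (h3 : ∀ i j, i + 1 < j → j ≤ m → a i * a j = a j * a i) (z : N) (hz : z ∈ gen a (m + 1)) :
    ∃ k d, k + d = m + 1 ∧ ∃ h ∈ gen a m, z = cyc a k d * h := by
  unfold gen at hz
  induction hz using Submonoid.closure_induction_left with
  | one => exact ⟨m + 1, 0, rfl, 1, one_mem _, by simp [cyc]⟩
  | mul_left x hx y hy ih =>
    obtain ⟨i, hi, rfl⟩ := hx
    obtain ⟨k, d, hkd, h, hh, rfl⟩ := ih
    simp only [Set.mem_ofPred_eq] at hi
    have hgen : ∀ j, j < m → a j ∈ gen a m := fun j hj => Submonoid.subset_closure ⟨j, hj, rfl⟩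
    rcases lt_trichotomy i k with hik | hik | hik
    · by_cases hik2 : i + 1 = k
      · subst hik2
        exact ⟨i, d + 1, by omega, h, hh, by simp only [cyc, mul_assoc]⟩
      · refine ⟨k, d, hkd, a i * h, mul_mem (hgen i (by omega)) hh, ?_⟩
        rw [← mul_assoc, cyc_comm a m h3 i d k (by omega) (by omega), mul_assoc]
    · subst hik
      obtain ⟨d, rfl⟩ : ∃ e, d = e + 1 := ⟨d - 1, by omega⟩
      refine ⟨i + 1, d, by omega, h, hh, ?_⟩
      simp only [cyc]
      rw [mul_assoc, ← mul_assoc (a i) (a i), h1 i (by omega), one_mul]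
    · obtain ⟨i, rfl⟩ : ∃ e, i = e + 1 := ⟨i - 1, by omega⟩
      refine ⟨k, d, hkd, a i * h, mul_mem (hgen i (by omega)) hh, ?_⟩
      rw [← mul_assoc, cyc_shift a m h2 h3 d k i (by omega) (by omega) (by omega), mul_assoc]

end Presentation

/-- adjacent transposition in `Perm (Fin (n+1))` -/
def adj (n : ℕ) (i : ℕ) : Equiv.Perm (Fin (n + 1)) :=
  if h : i < n then Equiv.swap ⟨i, by omega⟩ ⟨i + 1, by omega⟩ else 1

lemma adj_val (n i : ℕ) (h : i < n) (x : Fin (n + 1)) :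
    ((adj n i x : Fin (n + 1)) : ℕ) =
      if (x : ℕ) = i then i + 1 else if (x : ℕ) = i + 1 then i else x := by
  simp only [adj, h, dif_pos, Equiv.swap_apply_def, Fin.ext_iff]
  split_ifs <;> rfl

lemma adj_sq (n i : ℕ) : adj n i * adj n i = 1 := by
  unfold adj; split_ifs <;> simp

lemma adj_braid (n i : ℕ) (h : i + 1 < n) :
    adj n i * adj n (i + 1) * adj n i = adj n (i + 1) * adj n i * adj n (i + 1) := by
  ext x
  simp only [Equiv.Perm.mul_apply, adj_val n i (by omega), adj_val n (i + 1) h]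
  split_ifs <;> omega

lemma adj_comm (n i j : ℕ) (h : i + 1 < j) (hj : j < n) :
    adj n i * adj n j = adj n j * adj n i := by
  ext x
  simp only [Equiv.Perm.mul_apply, adj_val n i (by omega), adj_val n j hj]
  split_ifs <;> omega

section Hom

variable {M : Type*} [Monoid M] (n : ℕ) (t : ℕ → M)

/-- pair generators -/
def pr (i : ℕ) : M × Equiv.Perm (Fin (n + 1)) := (t i, adj n i)

lemma gen_fix (m : ℕ) (_hm : m ≤ n) (z : M × Equiv.Perm (Fin (n + 1))) (hz : z ∈ gen (pr n t) m)
    (x : Fin (n + 1)) (hx : m < x) : z.2 x = x := by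
  unfold gen at hz
  induction hz using Submonoid.closure_induction with
  | mem y hy =>
    obtain ⟨i, hi, rfl⟩ := hy
    simp only [Set.mem_ofPred_eq] at hi
    apply Fin.ext
    simp only [pr]
    rw [adj_val n i (by omega)]
    split_ifs <;> omega
  | one => simp
  | mul y z _ _ h1 h2 => simp [h1, h2]

lemma cyc_apply : ∀ (d k : ℕ) (_ : k + d ≤ n) (x : Fin (n + 1)), (x : ℕ) = k + d →
    (((cyc (pr n t) k d).2 x : Fin (n + 1)) : ℕ) = k := by
  intro d
  induction d with
  | zero => intro k _ x hx; simpa [cyc] using hx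
  | succ d ih =>
    intro k h x hx
    simp only [cyc, Prod.snd_mul, Equiv.Perm.mul_apply, pr]
    rw [adj_val n k (by omega)]
    have := ih (k + 1) (by omega) x (by omega)
    rw [if_neg (by omega), if_pos this]

lemma gen_unique
    (h1 : ∀ i, i < n → t i * t i = 1)
    (h2 : ∀ i, i + 1 < n → t i * t (i + 1) * t i = t (i + 1) * t i * t (i + 1))
    (h3 : ∀ i j, i + 1 < j → j < n → t i * t j = t j * t i) (m : ℕ) :
    m ≤ n → ∀ z ∈ gen (pr n t) m, ∀ w ∈ gen (pr n t) m, z.2 = w.2 → z = w := by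
  induction m with
  | zero =>
    intro _ z hz w hw _
    simp only [gen, not_lt_zero, Set.ofPred_false, Set.image_empty, Submonoid.closure_empty,
      Submonoid.mem_bot] at hz hw
    rw [hz, hw]
  | succ m ih =>
    intro hm z hz w hw hzw
    have H1 : ∀ i, i ≤ m → pr n t i * pr n t i = 1 := fun i hi =>
      Prod.ext (h1 i (by omega)) (adj_sq n i)
    have H2 : ∀ i, i + 1 ≤ m → pr n t i * pr n t (i + 1) * pr n t i =
        pr n t (i + 1) * pr n t i * pr n t (i + 1) := fun i hi =>
      Prod.ext (h2 i (by omega)) (adj_braid n i (by omega))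
    have H3 : ∀ i j, i + 1 < j → j ≤ m → pr n t i * pr n t j = pr n t j * pr n t i :=
      fun i j hij hj => Prod.ext (h3 i j hij (by omega)) (adj_comm n i j hij (by omega))
    obtain ⟨k, d, hkd, h, hh, rfl⟩ := gen_normal (pr n t) m H1 H2 H3 z hz
    obtain ⟨k', d', hkd', h', hh', rfl⟩ := gen_normal (pr n t) m H1 H2 H3 w hw
    have hkk : k = k' := by
      have := congrArg (fun g : Equiv.Perm (Fin (n + 1)) => ((g ⟨m + 1, by omega⟩ : Fin (n + 1)) : ℕ)) hzw
      simp only [Prod.snd_mul, Equiv.Perm.mul_apply] at this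
      rw [gen_fix n t m (by omega) h hh _ (by simp), gen_fix n t m (by omega) h' hh' _ (by simp),
        cyc_apply n t d k (by omega) _ (by simp; omega),
        cyc_apply n t d' k' (by omega) _ (by simp; omega)] at this
      exact this
    subst hkk
    have hdd : d = d' := by omega
    subst hdd
    congr 1
    apply ih (by omega) h hh h' hh'
    simpa using hzw

lemma exists_hom
    (h1 : ∀ i, i < n → t i * t i = 1)
    (h2 : ∀ i, i + 1 < n → t i * t (i + 1) * t i = t (i + 1) * t i * t (i + 1))
    (h3 : ∀ i j, i + 1 < j → j < n → t i * t j = t j * t i) :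
    ∃ φ : Equiv.Perm (Fin (n + 1)) →* M, ∀ i, i < n → φ (adj n i) = t i := by
  have huniq := gen_unique n t h1 h2 h3 n le_rfl
  have hex : ∀ g : Equiv.Perm (Fin (n + 1)), ∃ x : M, (x, g) ∈ gen (pr n t) n := by
    intro g
    have hg : g ∈ (⊤ : Submonoid (Equiv.Perm (Fin (n + 1)))) := trivial
    rw [← Equiv.Perm.mclosure_swap_castSucc_succ n] at hg
    induction hg using Submonoid.closure_induction with
    | mem y hy =>
      obtain ⟨i, rfl⟩ := hy
      refine ⟨t i, Submonoid.subset_closure ⟨i, i.2, ?_⟩⟩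
      simp only [pr, adj, i.2, dif_pos]
      rfl
    | one => exact ⟨1, one_mem _⟩
    | mul y z _ _ hy hz =>
      obtain ⟨a, ha⟩ := hy
      obtain ⟨b, hb⟩ := hz
      exact ⟨a * b, mul_mem ha hb⟩
  choose φ hφ using hex
  refine ⟨⟨⟨φ, ?_⟩, ?_⟩, ?_⟩
  · exact congrArg Prod.fst (huniq _ (hφ 1) _ (one_mem _) rfl)
  · intro x y
    exact congrArg Prod.fst (huniq _ (hφ (x * y)) _ (mul_mem (hφ x) (hφ y)) rfl)
  · intro i hi
    exact congrArg Prod.fst (huniq _ (hφ (adj n i)) (pr n t i)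
      (Submonoid.subset_closure ⟨i, hi, rfl⟩) rfl)

end Hom

lemma exists_young_rep (n : ℕ) (μ : YoungDiagram) :
    ∃ ρ : Representation ℂ (Equiv.Perm (Fin n)) (YoungSpace μ n),
        IsYoungOrthogonalRep μ n ρ := by
  rcases n with _ | n
  · exact ⟨1, fun p => p.elim0⟩
  set t : ℕ → Module.End ℂ (YoungSpace μ (n + 1)) := fun i =>
    if h : i < n then youngOp μ (n + 1) ⟨i, by omega⟩ ⟨i + 1, by omega⟩ else 1 with ht
  have ht' : ∀ i (h : i < n), t i = youngOp μ (n + 1) ⟨i, by omega⟩ ⟨i + 1, by omega⟩ :=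
    fun i h => by simp [ht, h]
  obtain ⟨φ, hφ⟩ := exists_hom n t
    (by
      intro i hi
      rw [ht' i hi]
      refine LinearMap.ext fun f => ?_
      obtain ⟨F, rfl⟩ := exists_res μ f
      simp only [Module.End.mul_apply, Module.End.one_apply]
      rw [youngOp_res μ _ _ rfl, youngOp_res μ _ _ rfl, fop_sq])
    (by
      intro i hi
      rw [ht' i (by omega), ht' (i + 1) hi]
      refine LinearMap.ext fun f => ?_
      obtain ⟨F, rfl⟩ := exists_res μ f
      simp only [Module.End.mul_apply]
      rw [youngOp_res μ _ _ rfl, youngOp_res μ _ _ rfl, youngOp_res μ _ _ rfl,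
        youngOp_res μ _ _ rfl, youngOp_res μ _ _ rfl, youngOp_res μ _ _ rfl]
      funext S
      refine fop_braid _ _ _ ?_ ?_ ?_ S.val ?_ ?_ ?_ F
      · simp
      · simp
      · simp only [ne_eq, Fin.mk.injEq]; omega
      · exact cont_ne S.2 _ _ (by simp) (by simp)
      · exact cont_ne S.2 _ _ (by simp) (by simp)
      · exact cont_ne S.2 _ _ (by simp only; omega) (by simp only; omega))
    (by
      intro i j hij hj
      rw [ht' i (by omega), ht' j hj]
      refine LinearMap.ext fun f => ?_
      obtain ⟨F, rfl⟩ := exists_res μ f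
      simp only [Module.End.mul_apply]
      rw [youngOp_res μ _ _ rfl, youngOp_res μ _ _ rfl, youngOp_res μ _ _ rfl,
        youngOp_res μ _ _ rfl, fop_comm]
      all_goals simp only [ne_eq, Fin.mk.injEq]; omega)
  refine ⟨φ, fun p q hpq => ?_⟩
  have hp : (p : ℕ) < n := by omega
  have := hφ p hp
  rw [ht' p hp] at this
  simp only [adj, hp, dif_pos] at this
  have hq : q = ⟨(p : ℕ) + 1, by omega⟩ := Fin.ext hpq
  rw [hq]
  exact this

/-- Jucys-Murphy operators, defined recursively. -/
def jm {n : ℕ} {V : Type*} [AddCommGroup V] [Module ℂ V]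
    (ρ : Representation ℂ (Equiv.Perm (Fin n)) V) : ℕ → Module.End ℂ V
  | 0 => 0
  | k + 1 => if h : k + 1 < n then
      ρ (Equiv.swap ⟨k, by omega⟩ ⟨k + 1, h⟩) * jm ρ k * ρ (Equiv.swap ⟨k, by omega⟩ ⟨k + 1, h⟩) +
        ρ (Equiv.swap ⟨k, by omega⟩ ⟨k + 1, h⟩) else 0

lemma jm_mem {n : ℕ} {V : Type*} [AddCommGroup V] [Module ℂ V]
    (ρ : Representation ℂ (Equiv.Perm (Fin n)) V) (p : Submodule ℂ V)
    (hp : ∀ g v, v ∈ p → ρ g v ∈ p) (k : ℕ) : ∀ v ∈ p, jm ρ k v ∈ p := by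
  induction k with
  | zero => intro v _; simp [jm]
  | succ k ih =>
    intro v hv
    simp only [jm]
    split_ifs with h
    · simp only [LinearMap.add_apply, Module.End.mul_apply]
      exact p.add_mem (hp _ _ (ih _ (hp _ _ hv))) (hp _ _ hv)
    · simp

lemma jm_equivariant {n : ℕ} {V W : Type*} [AddCommGroup V] [Module ℂ V]
    [AddCommGroup W] [Module ℂ W]
    (ρ : Representation ℂ (Equiv.Perm (Fin n)) V) (σ : Representation ℂ (Equiv.Perm (Fin n)) W)
    (e : V ≃ₗ[ℂ] W) (he : ∀ g v, e (ρ g v) = σ g (e v)) (k : ℕ) :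
    ∀ v, e (jm ρ k v) = jm σ k (e v) := by
  induction k with
  | zero => intro v; simp [jm]
  | succ k ih =>
    intro v
    simp only [jm]
    split_ifs with h
    · simp only [LinearMap.add_apply, Module.End.mul_apply, map_add, he, ih]
    · simp

lemma rho_mul {μ : YoungDiagram} {n : ℕ} {T : Fin n → ℕ × ℕ} (hT : IsStandardTableau μ n T)
    (p q : Fin n) (hpq : (q : ℕ) = p + 1) :
    (rhoCoef p q T : ℂ) * ((cont (T q) : ℂ) - (cont (T p) : ℂ)) = 1 := by
  have := cont_ne hT p q (by omega) (by omega)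
  rw [rho_eq]
  have d1 : ((cont (T q) : ℂ) - (cont (T p) : ℂ)) ≠ 0 := by
    rw [sub_ne_zero]; exact_mod_cast this.symm
  push_cast
  exact inv_mul_cancel₀ d1

lemma jm_young {n : ℕ} {μ : YoungDiagram}
    (ρ : Representation ℂ (Equiv.Perm (Fin n)) (YoungSpace μ n)) (hρ : IsYoungOrthogonalRep μ n ρ)
    (k : ℕ) : ∀ (hk : k < n) (f : YoungSpace μ n),
      jm ρ k f = fun S => (cont (S.val ⟨k, hk⟩) : ℂ) * f S := by
  induction k with
  | zero =>
    intro hk f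
    funext S
    simp [jm, std_zero S.2 ⟨0, hk⟩ rfl]
  | succ k ih =>
    intro hk f
    simp only [jm, hk, dif_pos]
    rw [hρ ⟨k, by omega⟩ ⟨k + 1, hk⟩ rfl]
    simp only [LinearMap.add_apply, Module.End.mul_apply]
    rw [ih (by omega)]
    obtain ⟨F, rfl⟩ := exists_res μ f
    rw [youngOp_res μ _ _ rfl]
    have : (fun S : {T : Fin n → ℕ × ℕ // IsStandardTableau μ n T} =>
        (cont (S.val ⟨k, by omega⟩) : ℂ) * res μ (fop ⟨k, by omega⟩ ⟨k + 1, hk⟩ F) S) =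
        res μ (fun S => (cont (S ⟨k, by omega⟩) : ℂ) * fop ⟨k, by omega⟩ ⟨k + 1, hk⟩ F S) := rfl
    rw [this, youngOp_res μ _ _ rfl]
    funext S
    have hS : (S.val ∘ Equiv.swap ⟨k, by omega⟩ ⟨k + 1, hk⟩) ∘
        Equiv.swap ⟨k, by omega⟩ ⟨k + 1, hk⟩ = S.val := by
      funext i; simp
    have h1 := rho_mul S.2 ⟨k, by omega⟩ ⟨k + 1, hk⟩ rfl
    have h2 := rc_sq ⟨k, by omega⟩ ⟨k + 1, hk⟩ S.val
    have h3 : (S.val ∘ Equiv.swap ⟨k, by omega⟩ ⟨k + 1, hk⟩) ⟨k, by omega⟩ = S.val ⟨k + 1, hk⟩ := by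
      simp
    simp only [res, Pi.add_apply, fop, rho_swap, rc_swap, hS, h3]
    push_cast
    linear_combination ((cont (S.val ⟨k + 1, hk⟩) : ℂ) * F S.val) * h2 +
      (-(rhoCoef ⟨k, by omega⟩ ⟨k + 1, hk⟩ S.val : ℂ) * F S.val -
       rc ⟨k, by omega⟩ ⟨k + 1, hk⟩ S.val *
        F (S.val ∘ Equiv.swap ⟨k, by omega⟩ ⟨k + 1, hk⟩)) * h1

lemma exists_std (μ : YoungDiagram) (n : ℕ) (hμ : μ.card = n) :
    ∃ T, IsStandardTableau μ n T := by
  classical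
  let s : Finset (ℕ ×ₗ ℕ) := μ.cells.map toLex.toEmbedding
  have hs : s.card = n := by rw [Finset.card_map]; exact hμ
  refine ⟨fun k => ofLex (s.orderEmbOfFin hs k), ?_, ?_, ?_⟩
  · intro a b h
    exact (s.orderEmbOfFin hs).injective (ofLex.injective h)
  · have h1 := Finset.range_orderEmbOfFin s hs
    have : (fun k => ofLex (s.orderEmbOfFin hs k)) = ofLex ∘ (s.orderEmbOfFin hs) := rfl
    rw [this, Set.range_comp, h1]
    simp [s, Finset.coe_map, Set.image_image]
  · intro j k h
    rw [← (s.orderEmbOfFin hs).lt_iff_lt, Prod.Lex.lt_iff]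
    dsimp only at h
    rcases h with ⟨h1, h2⟩ | ⟨h1, h2⟩
    · right; exact ⟨h1.symm, by omega⟩
    · left; omega

instance finite_std (μ : YoungDiagram) (n : ℕ) :
    Finite {T : Fin n → ℕ × ℕ // IsStandardTableau μ n T} := by
  let F : {T : Fin n → ℕ × ℕ // IsStandardTableau μ n T} → (Fin n → μ.cells) :=
    fun T k => ⟨T.val k, std_mem T.2 k⟩
  refine Finite.of_injective F ?_
  intro S T h
  apply Subtype.ext
  funext k
  exact congrArg Subtype.val (congrFun h k)

lemma isolate {n : ℕ} {μ : YoungDiagram}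
    (ρ : Representation ℂ (Equiv.Perm (Fin n)) (YoungSpace μ n)) (hρ : IsYoungOrthogonalRep μ n ρ)
    (p : Submodule ℂ (YoungSpace μ n)) (hp : ∀ g v, v ∈ p → ρ g v ∈ p)
    (f : YoungSpace μ n) (hf : f ∈ p) (T : {T : Fin n → ℕ × ℕ // IsStandardTableau μ n T})
    (hT : f T ≠ 0) (s : Finset {T : Fin n → ℕ × ℕ // IsStandardTableau μ n T}) :
    T ∉ s → ∃ g ∈ p, g T ≠ 0 ∧ ∀ S ∈ s, g S = 0 := by
  classical
  induction s using Finset.induction_on with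
  | empty => intro _; exact ⟨f, hf, hT, by simp⟩
  | insert S s hS ih =>
    intro hTs
    rw [Finset.mem_insert, not_or] at hTs
    obtain ⟨g, hg, hgT, hgs⟩ := ih hTs.2
    have : ∃ k, cont (T.val k) ≠ cont (S.val k) := by
      by_contra hc
      push Not at hc
      exact hTs.1 (Subtype.ext (eq_of_cont_eq T.2 S.2 hc))
    obtain ⟨k, hk⟩ := this
    refine ⟨jm ρ k g - (cont (S.val k) : ℂ) • g,
      p.sub_mem (jm_mem ρ p hp k g hg) (p.smul_mem _ hg), ?_, ?_⟩
    · rw [jm_young ρ hρ k k.2]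
      simp only [Fin.eta, Pi.sub_apply, Pi.smul_apply, smul_eq_mul, ← sub_mul]
      refine mul_ne_zero ?_ hgT
      rw [sub_ne_zero]
      exact_mod_cast hk
    · intro R hR
      rw [jm_young ρ hρ k k.2]
      simp only [Fin.eta, Pi.sub_apply, Pi.smul_apply, smul_eq_mul, ← sub_mul]
      rcases Finset.mem_insert.1 hR with rfl | hR
      · simp
      · simp [hgs R hR]

open scoped Classical in
lemma single_swap_mem {n : ℕ} {μ : YoungDiagram}
    (ρ : Representation ℂ (Equiv.Perm (Fin n)) (YoungSpace μ n)) (hρ : IsYoungOrthogonalRep μ n ρ)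
    (P : Submodule ℂ (YoungSpace μ n)) (hP : ∀ g v, v ∈ P → ρ g v ∈ P)
    (T : {T : Fin n → ℕ × ℕ // IsStandardTableau μ n T})
    (hT : (Pi.single T 1 : YoungSpace μ n) ∈ P) (p q : Fin n) (hpq : (q : ℕ) = p + 1)
    (h : IsStandardTableau μ n (T.val ∘ Equiv.swap p q)) :
    (Pi.single ⟨T.val ∘ Equiv.swap p q, h⟩ 1 : YoungSpace μ n) ∈ P := by
  have h1 : ρ (Equiv.swap p q) (Pi.single T 1) - (rhoCoef p q T.val : ℂ) • Pi.single T 1 ∈ P :=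
    P.sub_mem (hP _ _ hT) (P.smul_mem _ hT)
  have hr : rc p q T.val ≠ 0 := by
    intro h0
    have h2 := rc_sq p q T.val
    rw [h0] at h2
    have h3 := rho_mul T.2 p q hpq
    have h4 := cont_of_swap T.2 p q hpq h
    have h5 : ((cont (T.val q) : ℂ) - (cont (T.val p) : ℂ)) ^ 2 = 1 := by
      linear_combination (-((cont (T.val q) : ℂ) - (cont (T.val p) : ℂ)) ^ 2) * h2 +
        ((rhoCoef p q T.val : ℂ) * ((cont (T.val q) : ℂ) - (cont (T.val p) : ℂ)) + 1) * h3
    rcases mul_self_eq_one_iff.1 ((sq _).symm.trans h5) with h6 | h6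
    · apply h4.1; exact_mod_cast h6
    · apply h4.2; exact_mod_cast h6
  have h2 : ρ (Equiv.swap p q) (Pi.single T 1) - (rhoCoef p q T.val : ℂ) • Pi.single T 1 =
      rc p q T.val • (Pi.single ⟨T.val ∘ Equiv.swap p q, h⟩ 1 : YoungSpace μ n) := by
    rw [hρ p q hpq]
    have e1 : (Pi.single T 1 : YoungSpace μ n) = res μ (fun S => if S = T.val then 1 else 0) := by
      funext S
      simp [res, Pi.single_apply, Subtype.ext_iff]
    have e2 : (Pi.single ⟨T.val ∘ Equiv.swap p q, h⟩ 1 : YoungSpace μ n) =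
        res μ (fun S => if S = T.val ∘ Equiv.swap p q then 1 else 0) := by
      funext S
      simp [res, Pi.single_apply, Subtype.ext_iff]
    rw [e1, e2, youngOp_res μ p q hpq]
    funext S
    have e3 : S.val ∘ Equiv.swap p q = T.val ↔ S.val = T.val ∘ Equiv.swap p q := by
      constructor
      · intro h; rw [← h]; funext i; simp
      · intro h; rw [h]; funext i; simp
    simp only [res, fop, Pi.sub_apply, Pi.smul_apply, smul_eq_mul, e3]
    have e4 : rc p q S.val * (if S.val = T.val ∘ Equiv.swap p q then 1 else 0) =
        rc p q T.val * (if S.val = T.val ∘ Equiv.swap p q then 1 else 0) := by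
      split_ifs with hS
      · rw [hS, rc_swap]
      · simp
    have e5 : (rhoCoef p q S.val : ℂ) * (if S.val = T.val then 1 else 0) =
        rhoCoef p q T.val * (if S.val = T.val then 1 else 0) := by
      split_ifs with hS
      · rw [hS]
      · simp
    rw [e4, e5]
    ring
  rw [h2] at h1
  exact (P.smul_mem_iff hr).1 h1

lemma eq_or_descent {μ : YoungDiagram} {n : ℕ} {S T : Fin n → ℕ × ℕ}
    (hS : IsStandardTableau μ n S) (hT : IsStandardTableau μ n T) (π : Fin n → Fin n)
    (hπ : ∀ k, S (π k) = T k) : S = T ∨ ∃ p q : Fin n, (q : ℕ) = p + 1 ∧ π q < π p := by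
  have hinj : Function.Injective π := fun a b h => hT.1 (by rw [← hπ a, ← hπ b, h])
  by_cases hd : ∃ p q : Fin n, (q : ℕ) = p + 1 ∧ π q < π p
  · exact Or.inr hd
  left
  push Not at hd
  rcases n with _ | n
  · funext k; exact k.elim0
  have hmono : StrictMono π := by
    rw [Fin.strictMono_iff_lt_succ]
    intro i
    refine lt_of_le_of_ne (hd _ _ (by simp)) ?_
    intro h
    have := hinj h
    simp [Fin.ext_iff] at this
  have hid : π = id := by
    have e : (hmono.orderIsoOfSurjective π (Finite.surjective_of_injective hinj)) =
        OrderIso.refl _ := Subsingleton.elim _ _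
    funext k
    exact congrArg (fun e : Fin (n + 1) ≃o Fin (n + 1) => e k) e
  funext k
  rw [← hπ k, hid]; rfl

lemma all_mem {n : ℕ} {μ : YoungDiagram}
    (R : Set {T : Fin n → ℕ × ℕ // IsStandardTableau μ n T}) (hne : R.Nonempty)
    (hR : ∀ T ∈ R, ∀ p q : Fin n, (q : ℕ) = p + 1 →
      ∀ h : IsStandardTableau μ n (T.val ∘ Equiv.swap p q), ⟨T.val ∘ Equiv.swap p q, h⟩ ∈ R)
    (S : {T : Fin n → ℕ × ℕ // IsStandardTableau μ n T}) : S ∈ R := by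
  classical
  let m : ℕ × ℕ → ℤ := fun c => if h : ∃ j, S.val j = c then (((Classical.choose h : Fin n) : ℕ) : ℤ)
    else 0
  have hm : ∀ j, m (S.val j) = ((j : ℕ) : ℤ) := by
    intro j
    have h : ∃ i, S.val i = S.val j := ⟨j, rfl⟩
    have h2 := Classical.choose_spec h
    simp only [m, h, dif_pos]
    rw [S.2.1 h2]
  let w : {T : Fin n → ℕ × ℕ // IsStandardTableau μ n T} → ℤ :=
    fun T => ∑ k : Fin n, ((k : ℕ) : ℤ) * m (T.val k)
  obtain ⟨T, hTR, hmax⟩ := Set.exists_max_image R w (Set.toFinite R) hne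
  have hπ : ∀ k, ∃ j, S.val j = T.val k := fun k => std_surj S.2 _ (std_mem T.2 k)
  choose π hπ using hπ
  rcases eq_or_descent S.2 T.2 π hπ with h | ⟨p, q, hpq, hlt⟩
  · rwa [Subtype.ext h]
  exfalso
  have hstd : IsStandardTableau μ n (T.val ∘ Equiv.swap p q) := by
    refine std_swap_of T.2 p q hpq ?_
    intro h
    rw [← hπ p, ← hπ q] at h
    exact absurd (S.2.2.2 _ _ h) (not_lt.2 hlt.le)
  have hle := hmax _ (hR T hTR p q hpq hstd)
  have hne : p ≠ q := by intro h; rw [h] at hpq; omega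
  have e1 : w ⟨T.val ∘ Equiv.swap p q, hstd⟩ - w T =
      (m (T.val p) - m (T.val q)) := by
    simp only [w]
    rw [← Finset.sum_sub_distrib, Fintype.sum_eq_add p q hne]
    · simp only [Function.comp, Equiv.swap_apply_left, Equiv.swap_apply_right, hpq]
      push_cast; ring
    · rintro x ⟨h1, h2⟩
      simp [Equiv.swap_apply_of_ne_of_ne h1 h2]
  rw [← hπ p, ← hπ q, hm, hm] at e1
  rw [Fin.lt_def] at hlt
  omega

lemma young_irreducible {n : ℕ} {μ : YoungDiagram} (hμ : μ.card = n)
    (ρ : Representation ℂ (Equiv.Perm (Fin n)) (YoungSpace μ n))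
    (hρ : IsYoungOrthogonalRep μ n ρ) : RepIsIrreducible ρ := by
  classical
  constructor
  · obtain ⟨T, hT⟩ := exists_std μ n hμ
    refine ⟨Pi.single ⟨T, hT⟩ 1, ?_⟩
    intro h
    have := congrFun h ⟨T, hT⟩
    simp at this
  · intro P hP
    by_cases hbot : P = ⊥
    · exact Or.inl hbot
    right
    have := Fintype.ofFinite {T : Fin n → ℕ × ℕ // IsStandardTableau μ n T}
    obtain ⟨f, hf, hf0⟩ := P.exists_mem_ne_zero_of_ne_bot hbot
    obtain ⟨T, hT⟩ := Function.ne_iff.1 hf0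
    obtain ⟨g, hg, hgT, hgs⟩ := isolate ρ hρ P hP f hf T hT (Finset.univ.erase T) (by simp)
    have hgT' : g = g T • (Pi.single T 1 : YoungSpace μ n) := by
      funext S
      by_cases hS : S = T
      · subst hS; simp
      · simp [hS, hgs S (by simp [hS])]
    have hTP : (Pi.single T 1 : YoungSpace μ n) ∈ P := by
      rw [hgT'] at hg
      exact (P.smul_mem_iff hgT).1 hg
    have hall : ∀ S, (Pi.single S 1 : YoungSpace μ n) ∈ P := fun S =>
      all_mem {S | (Pi.single S 1 : YoungSpace μ n) ∈ P} ⟨T, hTP⟩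
        (fun T hT p q hpq h => single_swap_mem ρ hρ P hP T hT p q hpq h) S
    rw [eq_top_iff]
    intro v _
    rw [pi_eq_sum_univ' v]
    refine P.sum_mem fun S _ => P.smul_mem _ ?_
    convert hall S using 1

lemma young_not_iso {n : ℕ} {μ ν : YoungDiagram} (hμ : μ.card = n) (hne : μ ≠ ν)
    (ρμ : Representation ℂ (Equiv.Perm (Fin n)) (YoungSpace μ n))
    (ρν : Representation ℂ (Equiv.Perm (Fin n)) (YoungSpace ν n))
    (h1 : IsYoungOrthogonalRep μ n ρμ) (h2 : IsYoungOrthogonalRep ν n ρν) :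
    ¬ ∃ e : YoungSpace μ n ≃ₗ[ℂ] YoungSpace ν n,
            ∀ (g : Equiv.Perm (Fin n)) (v : YoungSpace μ n),
              e (ρμ g v) = ρν g (e v) := by
  classical
  rintro ⟨e, he⟩
  obtain ⟨T, hT⟩ := exists_std μ n hμ
  have hne0 : e (Pi.single ⟨T, hT⟩ 1) ≠ 0 := by
    rw [Ne, LinearEquiv.map_eq_zero_iff]
    intro h
    have := congrFun h ⟨T, hT⟩
    simp at this
  obtain ⟨S, hS⟩ := Function.ne_iff.1 hne0
  have hc : ∀ k, cont (T k) = cont (S.val k) := by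
    intro k
    have h3 := jm_equivariant ρμ ρν e he k (Pi.single ⟨T, hT⟩ 1)
    rw [jm_young ρμ h1 k k.2, jm_young ρν h2 k k.2] at h3
    have h4 : (fun S : {T : Fin n → ℕ × ℕ // IsStandardTableau μ n T} =>
        (cont (S.val ⟨k, k.2⟩) : ℂ) * (Pi.single ⟨T, hT⟩ 1 : YoungSpace μ n) S) =
        (cont (T k) : ℂ) • (Pi.single ⟨T, hT⟩ 1 : YoungSpace μ n) := by
      funext R
      by_cases hR : R = ⟨T, hT⟩
      · subst hR; simp
      · simp [hR]
    rw [h4, map_smul] at h3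
    have h5 := congrFun h3 S
    simp only [Pi.smul_apply, smul_eq_mul, Fin.eta] at h5
    have := mul_right_cancel₀ hS h5
    exact_mod_cast this
  have hTS := eq_of_cont_eq hT S.2 hc
  apply hne
  apply YoungDiagram.ext
  have h3 := hT.2.1
  rw [hTS, S.2.2.1] at h3
  exact_mod_cast h3.symm

lemma card_cellsOfRowLens (w : List ℕ) : (YoungDiagram.cellsOfRowLens w).card = w.sum := by
  induction w with
  | nil => simp [YoungDiagram.cellsOfRowLens]
  | cons a w ih =>
    simp only [YoungDiagram.cellsOfRowLens, List.sum_cons]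
    rw [Finset.card_union_of_disjoint, Finset.card_map, ih]
    · simp
    · rw [Finset.disjoint_left]
      rintro ⟨x, y⟩ h1 h2
      simp only [Finset.mem_product, Finset.mem_singleton] at h1
      rw [Finset.mem_map] at h2
      obtain ⟨c, _, hc⟩ := h2
      have := congrArg Prod.fst hc
      simp at this
      omega

lemma exists_diagrams (n : ℕ) : ∃ d : n.Partition → YoungDiagram,
    Function.Injective d ∧ ∀ p, (d p).card = n := by
  have hs : ∀ p : n.Partition, (p.parts.sort (· ≥ ·)).SortedGE := fun p => by
    exact (Multiset.pairwise_sort _ _).sortedGE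
  refine ⟨fun p => YoungDiagram.ofRowLens (p.parts.sort (· ≥ ·)) (hs p), ?_, ?_⟩
  · intro p q h
    have hpos : ∀ (p : n.Partition), ∀ x ∈ p.parts.sort (· ≥ ·), 0 < x := fun p x hx =>
      p.parts_pos (by simpa using hx)
    have h2 := congrArg YoungDiagram.rowLens h
    simp only at h2
    rw [YoungDiagram.rowLens_ofRowLens_eq_self (hpos p),
      YoungDiagram.rowLens_ofRowLens_eq_self (hpos q)] at h2
    apply Nat.Partition.ext
    rw [← Multiset.sort_eq p.parts (· ≥ ·), h2, Multiset.sort_eq]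
  · intro p
    show (YoungDiagram.cellsOfRowLens _).card = n
    rw [card_cellsOfRowLens, ← Multiset.sum_coe, Multiset.sort_eq, p.parts_sum]

lemma irr_of {G V : Type*} [Group G] [AddCommGroup V] [Module ℂ V] (ρ : Representation ℂ G V)
    (h : RepIsIrreducible ρ) : ρ.IsIrreducible := by
  obtain ⟨⟨v, hv⟩, h⟩ := h
  refine { exists_pair_ne := ⟨⊥, ⊤, ?_⟩, eq_bot_or_eq_top := ?_ }
  · intro e
    have : v ∈ (⊤ : Subrepresentation ρ).toSubmodule := Submodule.mem_top
    rw [← e] at this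
    exact hv ((Submodule.mem_bot ℂ).1 this)
  · intro p
    rcases h p.toSubmodule (fun g v hv => p.apply_mem_toSubmodule g hv) with h | h
    · left; exact Subrepresentation.toSubmodule_injective h
    · right; exact Subrepresentation.toSubmodule_injective h

lemma findim_of_irr {G V : Type*} [Group G] [Finite G] [AddCommGroup V] [Module ℂ V]
    (ρ : Representation ℂ G V) (h : RepIsIrreducible ρ) : FiniteDimensional ℂ V := by
  obtain ⟨⟨v, hv⟩, h⟩ := h
  have hmem : ∀ g, ρ g v ∈ Submodule.span ℂ (Set.range fun g => ρ g v) := fun g =>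
    Submodule.subset_span ⟨g, rfl⟩
  rcases h (Submodule.span ℂ (Set.range fun g => ρ g v)) (by
    intro g w hw
    induction hw using Submodule.span_induction with
    | mem x hx =>
      obtain ⟨a, rfl⟩ := hx
      have := hmem (g * a)
      rwa [map_mul] at this
    | zero => simp
    | add x y _ _ hx hy => rw [map_add]; exact Submodule.add_mem _ hx hy
    | smul c x _ hx => rw [map_smul]; exact Submodule.smul_mem _ _ hx) with h0 | h0
  · exfalso
    have := hmem 1
    rw [h0] at this
    simp at this
    exact hv this
  · refine ⟨?_⟩
    rw [← h0]
    exact Submodule.fg_span (Set.finite_range _)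

lemma char_indep {G : Type*} [Group G] [Fintype G] {ι : Type*} (χ : ι → G → ℂ)
    (hχ : ∀ i j, (Nat.card G : ℂ)⁻¹ * ∑ g : G, χ i g * χ j g⁻¹ ≠ 0 ↔ i = j) :
    LinearIndependent ℂ χ := by
  classical
  rw [linearIndependent_iff']
  intro s c hc i hi
  have h1 : (Nat.card G : ℂ)⁻¹ * ∑ g : G, (∑ j ∈ s, c j • χ j) g * χ i g⁻¹ = 0 := by
    rw [hc]; simp
  have h2 : (Nat.card G : ℂ)⁻¹ * ∑ g : G, (∑ j ∈ s, c j • χ j) g * χ i g⁻¹ =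
      ∑ j ∈ s, c j * ((Nat.card G : ℂ)⁻¹ * ∑ g : G, χ j g * χ i g⁻¹) := by
    simp only [Finset.sum_apply, Pi.smul_apply, smul_eq_mul, Finset.sum_mul, Finset.mul_sum]
    rw [Finset.sum_comm]
    refine Finset.sum_congr rfl fun j _ => Finset.sum_congr rfl fun g _ => ?_
    ring
  rw [h2, Finset.sum_eq_single i] at h1
  · exact (mul_eq_zero.1 h1).resolve_right ((hχ i i).2 rfl)
  · intro j _ hj
    have := (not_congr (hχ j i)).2 hj
    rw [not_not] at this
    rw [this, mul_zero]
  · intro h; exact absurd hi h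

lemma exists_iso (n : ℕ) (W : Type*) [AddCommGroup W] [Module ℂ W]
    (σ : Representation ℂ (Equiv.Perm (Fin n)) W) (hσ : RepIsIrreducible σ) :
    ∃ (μ : YoungDiagram) (_ : μ.card = n)
        (ρ : Representation ℂ (Equiv.Perm (Fin n)) (YoungSpace μ n)),
        IsYoungOrthogonalRep μ n ρ ∧
        ∃ e : YoungSpace μ n ≃ₗ[ℂ] W,
          ∀ (g : Equiv.Perm (Fin n)) (v : YoungSpace μ n),
            e (ρ g v) = σ g (e v) := by
  classical
  by_contra hcon
  obtain ⟨d, hdinj, hdcard⟩ := exists_diagrams n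
  choose ρ hρ using fun μ => exists_young_rep n μ
  have hirr := fun p => irr_of _ (young_irreducible (hdcard p) (ρ (d p)) (hρ (d p)))
  have hfin := findim_of_irr σ hσ
  have hσirr := irr_of σ hσ
  have : Invertible (Nat.card (Equiv.Perm (Fin n)) : ℂ) :=
    invertibleOfNonzero (by exact_mod_cast Nat.card_pos.ne')
  let χ : Option n.Partition → Equiv.Perm (Fin n) → ℂ := fun o =>
    o.elim σ.character (fun p => (ρ (d p)).character)
  have hVW : ∀ p, ¬ Nonempty ((ρ (d p)).Equiv σ) := by
    rintro p ⟨e⟩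
    exact hcon ⟨d p, hdcard p, ρ (d p), hρ _, e.toLinearEquiv, fun g v => e.toIntertwiningMap.isIntertwining _ _ g v⟩
  have hWV : ∀ p, ¬ Nonempty (σ.Equiv (ρ (d p))) := fun p ⟨e⟩ => hVW p ⟨e.symm⟩
  have hVV : ∀ p q, Nonempty ((ρ (d p)).Equiv (ρ (d q))) → p = q := by
    rintro p q ⟨e⟩
    by_contra hne
    exact young_not_iso (hdcard p) (fun h => hne (hdinj h)) (ρ (d p)) (ρ (d q)) (hρ _) (hρ _)
      ⟨e.toLinearEquiv, fun g v => e.toIntertwiningMap.isIntertwining _ _ g v⟩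
  have hind : LinearIndependent ℂ χ := by
    apply char_indep
    rintro (_ | p) (_ | q)
    · simp only [χ, Option.elim]
      rw [Representation.char_orthonormal, if_pos ⟨Representation.Equiv.refl σ⟩]; simp
    · simp only [χ, Option.elim]
      rw [Representation.char_orthonormal, if_neg (hVW q)]; simp
    · simp only [χ, Option.elim]
      rw [Representation.char_orthonormal, if_neg (hWV p)]; simp
    · simp only [χ, Option.elim]
      rw [Representation.char_orthonormal]
      by_cases h : p = q
      · subst h; rw [if_pos ⟨Representation.Equiv.refl _⟩]; simp
      · rw [if_neg (fun h' => h (hVV q p h').symm)]; simpa using h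
  -- all characters factor through the cycle type
  let L : ((Fintype.card (Fin n)).Partition → ℂ) →ₗ[ℂ] (Equiv.Perm (Fin n) → ℂ) :=
    LinearMap.funLeft ℂ ℂ (fun g : Equiv.Perm (Fin n) => g.partition)
  have hfac : ∀ f : Equiv.Perm (Fin n) → ℂ, (∀ g h, f (h * g * h⁻¹) = f g) →
      f ∈ LinearMap.range L := by
    intro f hf
    refine ⟨Function.extend (fun g : Equiv.Perm (Fin n) => g.partition) f 0, ?_⟩
    funext g
    have : Function.FactorsThrough f (fun g : Equiv.Perm (Fin n) => g.partition) := by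
      intro a b hab
      obtain ⟨c, hc⟩ := isConj_iff.1 (Equiv.Perm.partition_eq_of_isConj.2 hab)
      rw [← hc, hf]
    exact this.extend_apply 0 g
  have hrange : ∀ o, χ o ∈ LinearMap.range L := by
    rintro (_ | p)
    · exact hfac _ (fun g h => σ.char_conj g h)
    · exact hfac _ (fun g h => (ρ (d p)).char_conj g h)
  have hind2 : LinearIndependent ℂ (fun o => (⟨χ o, hrange o⟩ : LinearMap.range L)) :=
    LinearIndependent.of_comp (LinearMap.range L).subtype hind
  have hcard := hind2.fintype_card_le_finrank
  have h2 := LinearMap.finrank_range_le L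
  rw [Module.finrank_fintype_fun_eq_card] at h2
  rw [Fintype.card_option] at hcard
  have h3 : Fintype.card (Fintype.card (Fin n)).Partition = Fintype.card n.Partition := by
    congr!; simp
  omega

end YoungProof

/-- **Young's Orthogonal Form.**  For each partition `μ` of `n`:
(1) the orthogonal-form formulas define a representation of `Sₙ` on the space `V^μ`
with basis indexed by the standard `μ`-tableaux (i.e. there is a representation in which
every adjacent transposition acts by the prescribed operators), and this representation
is irreducible;
(2) for distinct partitions `μ ≠ ν` of `n` the corresponding representations are not
isomorphic;
(3) every irreducible complex representation of `Sₙ` is isomorphic to `V^μ` for some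
partition `μ` of `n`. -/
theorem youngs_orthogonal_form (n : ℕ) :
    (∀ μ : YoungDiagram, μ.card = n →
      ∃ ρ : Representation ℂ (Equiv.Perm (Fin n)) (YoungSpace μ n),
        IsYoungOrthogonalRep μ n ρ ∧ RepIsIrreducible ρ) ∧
    (∀ μ ν : YoungDiagram, μ.card = n → ν.card = n → μ ≠ ν →
      ∀ (ρμ : Representation ℂ (Equiv.Perm (Fin n)) (YoungSpace μ n))
        (ρν : Representation ℂ (Equiv.Perm (Fin n)) (YoungSpace ν n)),
        IsYoungOrthogonalRep μ n ρμ → IsYoungOrthogonalRep ν n ρν →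
        ¬ ∃ e : YoungSpace μ n ≃ₗ[ℂ] YoungSpace ν n,
            ∀ (g : Equiv.Perm (Fin n)) (v : YoungSpace μ n),
              e (ρμ g v) = ρν g (e v)) ∧
    (∀ (W : Type*) [AddCommGroup W] [Module ℂ W]
        (σ : Representation ℂ (Equiv.Perm (Fin n)) W),
      RepIsIrreducible σ →
      ∃ (μ : YoungDiagram) (_ : μ.card = n)
        (ρ : Representation ℂ (Equiv.Perm (Fin n)) (YoungSpace μ n)),
        IsYoungOrthogonalRep μ n ρ ∧
        ∃ e : YoungSpace μ n ≃ₗ[ℂ] W,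
          ∀ (g : Equiv.Perm (Fin n)) (v : YoungSpace μ n),
            e (ρ g v) = σ g (e v)) := by
  refine ⟨?_, ?_, ?_⟩
  · intro μ hμ
    obtain ⟨ρ, hρ⟩ := YoungProof.exists_young_rep n μ
    exact ⟨ρ, hρ, YoungProof.young_irreducible hμ ρ hρ⟩
  · intro μ ν hμ _ hne ρμ ρν h1 h2
    exact YoungProof.young_not_iso hμ hne ρμ ρν h1 h2
  · intro W _ _ σ hσ
    exact YoungProof.exists_iso n W σ hσ
end

section
/- (Murnaghan–Nakayama Rule) Let λ be a partition of n, let χ^λ be the character of the representation V^λ of S_n given by Young's orthogonal form, and let c ∈ S_n be a permutation of cycle type ρ = (ρ_1, …, ρ_l). Then χ^λ(c) = Σ_H (−1)^{L(H)}, where the sum is over all sequences H of partitions ∅ = λ(0) ⊂ λ(1) ⊂ ⋯ ⊂ λ(l) = λ such that for each 1 ≤ i ≤ l the skew shape λ(i)/λ(i−1) is a skew hook with ρ_i boxes, and L(H) = Σ_{i=1}^l L(λ(i)/λ(i−1)). -/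
/-- The multiset of contents `s − r` of a finite set of boxes `(r, s)`, as a finset. -/
def contentsOf (s : Finset (ℕ × ℕ)) : Finset ℤ :=
  s.image (fun p => (p.2 : ℤ) - (p.1 : ℤ))

/-- A finite set of boxes is a skew hook if it is nonempty, no two of its boxes lie on
the same diagonal (the contents are pairwise distinct), and its contents form an
interval of integers. -/
def IsSkewHook (s : Finset (ℕ × ℕ)) : Prop :=
  s.Nonempty ∧ (contentsOf s).card = s.card ∧
    ∃ a : ℤ, contentsOf s = (Finset.range s.card).image (fun t : ℕ => a + (t : ℤ))

/-- `L(λ/μ)`: the number of rows occupied by a skew shape, minus one. -/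
def skewL (s : Finset (ℕ × ℕ)) : ℕ := (s.image Prod.fst).card - 1

/-- `hookStep k μ λ` holds when `μ ⊆ λ` and the skew shape `λ/μ` is a skew hook with `k`
boxes. -/
def hookStep (k : ℕ) (μ lam : YoungDiagram) : Prop :=
  μ ≤ lam ∧ (lam.cells \ μ.cells).card = k ∧ IsSkewHook (lam.cells \ μ.cells)


namespace MN

def rt (a : ℕ × ℕ) : ℕ × ℕ := (a.1, a.2 + 1)
def dn (a : ℕ × ℕ) : ℕ × ℕ := (a.1 + 1, a.2)
def dg (a : ℕ × ℕ) : ℕ × ℕ := (a.1 + 1, a.2 + 1)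
def cz (a : ℕ × ℕ) : ℤ := (a.2 : ℤ) - (a.1 : ℤ)
def cc (a : ℕ × ℕ) : ℂ := (cz a : ℂ)

def Conv (θ : Finset (ℕ × ℕ)) : Prop :=
  ∀ a ∈ θ, ∀ b ∈ θ, ∀ x : ℕ × ℕ, a.1 ≤ x.1 → a.2 ≤ x.2 → x.1 ≤ b.1 → x.2 ≤ b.2 → x ∈ θ

def NSq (θ : Finset (ℕ × ℕ)) : Prop := ∀ a ∈ θ, dg a ∉ θ

def maxs (θ : Finset (ℕ × ℕ)) : Finset (ℕ × ℕ) := θ.filter (fun a => rt a ∉ θ ∧ dn a ∉ θ)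
def meets (θ : Finset (ℕ × ℕ)) : Finset (ℕ × ℕ) := θ.filter (fun a => rt a ∈ θ ∧ dn a ∈ θ)

lemma cc_inj_iff {a b : ℕ × ℕ} : cc a = cc b ↔ cz a = cz b := by simp [cc]

lemma inj_of_nsq {θ : Finset (ℕ × ℕ)} (hc : Conv θ) (hn : NSq θ) {a b : ℕ × ℕ}
    (ha : a ∈ θ) (hb : b ∈ θ) (h : cz a = cz b) : a = b := by
  unfold cz at h
  rcases lt_trichotomy a.1 b.1 with h1 | h1 | h1
  · exact absurd (hc a ha b hb (dg a) (by simp [dg]) (by simp [dg]) (by simp [dg]; omega)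
      (by simp [dg]; omega)) (hn a ha)
  · exact Prod.ext h1 (by omega)
  · exact absurd (hc b hb a ha (dg b) (by simp [dg]) (by simp [dg]) (by simp [dg]; omega)
      (by simp [dg]; omega)) (hn b hb)

/-- factor of a box -/
noncomputable def phi (θ : Finset (ℕ × ℕ)) (v : ℂ) (a : ℕ × ℕ) : ℂ :=
  if rt a ∈ θ then (if dn a ∈ θ then -(v - cc a) else 1)
  else (if dn a ∈ θ then -1 else (v - cc a)⁻¹)

open scoped Classical in
noncomputable def GG (θ : Finset (ℕ × ℕ)) (v : ℂ) : ℂ :=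
  if NSq θ then ∏ a ∈ θ, phi θ v a else 0

lemma GG_empty (v : ℂ) : GG ∅ v = 1 := by
  simp [GG, NSq]

lemma rt_ne (a : ℕ × ℕ) : rt a ≠ a := by
  intro h; have := congrArg Prod.snd h; simp [rt] at this

lemma dn_ne (a : ℕ × ℕ) : dn a ≠ a := by
  intro h; have := congrArg Prod.fst h; simp [dn] at this

lemma conv_erase {θ : Finset (ℕ × ℕ)} (hc : Conv θ) {b : ℕ × ℕ} (hb : b ∈ maxs θ) :
    Conv (θ.erase b) := by
  intro x hx y hy z h1 h2 h3 h4
  simp only [Finset.mem_erase] at hx hy ⊢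
  refine ⟨?_, hc x hx.2 y hy.2 z h1 h2 h3 h4⟩
  rintro rfl
  simp only [maxs, Finset.mem_filter] at hb
  by_cases h5 : z.1 < y.1
  · exact hb.2.2 (hc z hb.1 y hy.2 _ (by simp [dn]) (by simp [dn]) (by simp [dn]; omega) (by simp [dn]; omega))
  · by_cases h6 : z.2 < y.2
    · exact hb.2.1 (hc z hb.1 y hy.2 _ (by simp [rt]) (by simp [rt]) (by simp [rt]; omega) (by simp [rt]; omega))
    · exact hy.1 (Prod.ext (by omega) (by omega))

lemma phi_erase {θ : Finset (ℕ × ℕ)} (hn : NSq θ) {a b : ℕ × ℕ}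
    (ha : a ∈ θ) (hb : b ∈ maxs θ) :
    phi (θ.erase b) (cc b) a = phi θ (cc b) a := by
  have hbθ : b ∈ θ := (Finset.mem_filter.1 hb).1
  by_cases h1 : rt a = b
  · have h2 : dn a ≠ b := by
      rw [← h1]; intro h; have := congrArg Prod.fst h; simp [rt, dn] at this
    have h3 : cc b - cc a = 1 := by
      rw [← h1]; simp [cc, cz, rt]
    have h4 : rt a ∈ θ := h1 ▸ hbθ
    simp [phi, h1, h2, h3, h4]
  · by_cases h2 : dn a = b
    · have h3 : cc b - cc a = -1 := by
        rw [← h2]; simp [cc, cz, dn]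
      have h4 : dn a ∈ θ := h2 ▸ hbθ
      simp [phi, h1, h2, h3, h4]
    · simp [phi, h1, h2]

lemma GG_erase_nsq {θ : Finset (ℕ × ℕ)} (hn : NSq θ) {b : ℕ × ℕ}
    (hb : b ∈ maxs θ) :
    GG (θ.erase b) (cc b) = ∏ a ∈ θ.erase b, phi θ (cc b) a := by
  have h : NSq (θ.erase b) := by
    intro a ha h
    exact hn a (Finset.mem_of_mem_erase ha) (Finset.mem_of_mem_erase h)
  rw [GG, if_pos h]
  exact Finset.prod_congr rfl fun a ha => phi_erase hn (Finset.mem_of_mem_erase ha) hb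

lemma GG_erase_sq {θ : Finset (ℕ × ℕ)} (hc : Conv θ) (hn : ¬ NSq θ) {b : ℕ × ℕ}
    (hb : b ∈ maxs θ) :
    GG (θ.erase b) (cc b) = 0 := by
  rw [GG]
  split_ifs with h
  swap
  · rfl
  simp only [NSq, not_forall, not_not] at hn
  obtain ⟨a, ha, had⟩ := hn
  have hr : rt a ∈ θ := hc a ha _ had _ (by simp [rt]) (by simp [rt]) (by simp [rt, dg]) (by simp [rt, dg])
  have hd : dn a ∈ θ := hc a ha _ had _ (by simp [dn]) (by simp [dn]) (by simp [dn, dg]) (by simp [dn, dg])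
  have hb' := Finset.mem_filter.1 hb
  have hab : a ≠ b := by rintro rfl; exact hb'.2.1 hr
  have hdb : dg a = b := by
    by_contra hne
    exact h a (Finset.mem_erase.2 ⟨hab, ha⟩) (Finset.mem_erase.2 ⟨hne, had⟩)
  have hrb : rt a ≠ b := by
    rw [← hdb]; intro h; have := congrArg Prod.fst h; simp [rt, dg] at this
  have hdnb : dn a ≠ b := by
    rw [← hdb]; intro h; have := congrArg Prod.snd h; simp [dn, dg] at this
  apply Finset.prod_eq_zero (Finset.mem_erase.2 ⟨hab, ha⟩)
  have h3 : cc b - cc a = 0 := by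
    rw [← hdb]; simp [cc, cz, dg]
  simp [phi, hrb, hdnb, hr, hd, h3]

/-- The sign. -/
noncomputable def sg (θ : Finset (ℕ × ℕ)) : ℂ := (-1) ^ (θ.filter (fun a => dn a ∈ θ)).card

lemma prod_phi_erase {θ : Finset (ℕ × ℕ)} {b : ℕ × ℕ} (hb : b ∈ maxs θ) (v : ℂ) :
    ∏ a ∈ θ.erase b, phi θ v a =
      sg θ * ((∏ a ∈ meets θ, (v - cc a)) / ∏ a ∈ (maxs θ).erase b, (v - cc a)) := by
  have hb' := Finset.mem_filter.1 hb
  have key : ∀ a ∈ θ.erase b, phi θ v a = (if dn a ∈ θ then -1 else 1) *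
      ((if rt a ∈ θ ∧ dn a ∈ θ then (v - cc a) else 1) *
       (if rt a ∉ θ ∧ dn a ∉ θ then (v - cc a)⁻¹ else 1)) := by
    intro a ha
    by_cases h1 : rt a ∈ θ <;> by_cases h2 : dn a ∈ θ <;> simp [phi, h1, h2]
  rw [Finset.prod_congr rfl key, Finset.prod_mul_distrib, Finset.prod_mul_distrib]
  congr 1
  · rw [← Finset.prod_filter, Finset.prod_const, sg]
    congr 2
    ext a
    simp only [Finset.mem_filter, Finset.mem_erase]
    constructor
    · tauto
    · rintro ⟨h1, h2⟩
      refine ⟨⟨?_, h1⟩, h2⟩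
      rintro rfl
      exact hb'.2.2 h2
  · rw [div_eq_mul_inv, ← Finset.prod_inv_distrib, ← Finset.prod_filter, ← Finset.prod_filter]
    congr 1
    · apply Finset.prod_congr _ (fun _ _ => rfl)
      ext a
      simp only [Finset.mem_filter, Finset.mem_erase, meets]
      constructor
      · tauto
      · rintro ⟨h1, h2⟩
        refine ⟨⟨?_, h1⟩, h2⟩
        rintro rfl
        exact hb'.2.2 h2.2
    · apply Finset.prod_congr _ (fun _ _ => rfl)
      ext a
      simp only [Finset.mem_filter, Finset.mem_erase, maxs]
      tauto

lemma prod_phi {θ : Finset (ℕ × ℕ)} (v : ℂ) :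
    ∏ a ∈ θ, phi θ v a =
      sg θ * ((∏ a ∈ meets θ, (v - cc a)) / ∏ a ∈ (maxs θ), (v - cc a)) := by
  have key : ∀ a ∈ θ, phi θ v a = (if dn a ∈ θ then -1 else 1) *
      ((if rt a ∈ θ ∧ dn a ∈ θ then (v - cc a) else 1) *
       (if rt a ∉ θ ∧ dn a ∉ θ then (v - cc a)⁻¹ else 1)) := by
    intro a ha
    by_cases h1 : rt a ∈ θ <;> by_cases h2 : dn a ∈ θ <;> simp [phi, h1, h2]
  rw [Finset.prod_congr rfl key, Finset.prod_mul_distrib, Finset.prod_mul_distrib]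
  congr 1
  · rw [← Finset.prod_filter, Finset.prod_const, sg]
  · rw [div_eq_mul_inv, ← Finset.prod_inv_distrib, ← Finset.prod_filter, ← Finset.prod_filter]
    rfl

/-- Boxes whose content successor is not a content. -/
def tops (θ : Finset (ℕ × ℕ)) : Finset (ℕ × ℕ) := θ.filter (fun a => cz a + 1 ∉ θ.image cz)

lemma sum_dn (θ : Finset (ℕ × ℕ)) : 
    (θ.filter (fun a => dn a ∈ θ)).card = (θ.filter (fun a => ∃ x ∈ θ, dn x = a)).card := by
  rw [← Finset.card_image_of_injective (θ.filter (fun a => dn a ∈ θ)) (f := dn)]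
  · congr 1
    ext a
    simp only [Finset.mem_image, Finset.mem_filter]
    constructor
    · rintro ⟨x, ⟨h1, h2⟩, rfl⟩; exact ⟨h2, x, h1, rfl⟩
    · rintro ⟨h2, x, h1, rfl⟩; exact ⟨x, ⟨h1, h2⟩, rfl⟩
  · intro a b h
    simp only [dn, Prod.mk.injEq] at h
    exact Prod.ext (by omega) h.2

lemma edge_iff {θ : Finset (ℕ × ℕ)} (hc : Conv θ) (hn : NSq θ) {a : ℕ × ℕ} (ha : a ∈ θ) :
    cz a + 1 ∈ θ.image cz ↔ (rt a ∈ θ ∨ ∃ x ∈ θ, dn x = a) := by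
  constructor
  · intro h
    obtain ⟨x, hx, hxa⟩ := Finset.mem_image.1 h
    unfold cz at hxa
    by_cases h1 : x.1 = a.1
    · left
      have : rt a = x := Prod.ext h1.symm (by simp [rt]; omega)
      rwa [this]
    by_cases h2 : x.1 + 1 = a.1
    · right
      exact ⟨x, hx, Prod.ext (by simp [dn]; omega) (by simp [dn]; omega)⟩
    exfalso
    by_cases h3 : x.1 < a.1
    · exact hn x hx (hc x hx a ha _ (by simp [dg]) (by simp [dg]) (by simp [dg]; omega) (by simp [dg]; omega))
    · exact hn a ha (hc a ha x hx _ (by simp [dg]) (by simp [dg]) (by simp [dg]; omega) (by simp [dg]; omega))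
  · rintro (h | ⟨x, hx, rfl⟩)
    · exact Finset.mem_image.2 ⟨_, h, by simp [cz, rt]; ring⟩
    · exact Finset.mem_image.2 ⟨_, hx, by simp [cz, dn]; ring⟩

lemma count_edges {θ : Finset (ℕ × ℕ)} (hc : Conv θ) (hn : NSq θ) :
    (tops θ).card + (θ.filter (fun a => dn a ∈ θ)).card + (θ.filter (fun a => rt a ∈ θ)).card
      = θ.card := by
  rw [sum_dn, add_assoc, ← Finset.card_union_of_disjoint, tops, ← Finset.filter_or]
  · rw [add_comm, Finset.filter_congr (q := fun a => cz a + 1 ∈ θ.image cz)]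
    · exact Finset.card_filter_add_card_filter_not _
    · intro a ha
      rw [edge_iff hc hn ha, or_comm]
  · rw [Finset.disjoint_left]
    intro a h1 h2
    obtain ⟨h1, x, hx, rfl⟩ := Finset.mem_filter.1 h1
    obtain ⟨_, h2⟩ := Finset.mem_filter.1 h2
    exact hn x hx h2

lemma count_max (θ : Finset (ℕ × ℕ)) :
    (θ.filter (fun a => dn a ∈ θ)).card + (θ.filter (fun a => rt a ∈ θ)).card + (maxs θ).card
      = θ.card + (meets θ).card := by
  simp only [maxs, meets, Finset.card_filter, Finset.card_eq_sum_ones θ]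
  rw [← Finset.sum_add_distrib, ← Finset.sum_add_distrib, ← Finset.sum_add_distrib]
  apply Finset.sum_congr rfl
  intro a ha
  by_cases h1 : rt a ∈ θ <;> by_cases h2 : dn a ∈ θ <;> simp [h1, h2]

lemma card_maxs {θ : Finset (ℕ × ℕ)} (hc : Conv θ) (hn : NSq θ) :
    (maxs θ).card = (meets θ).card + (tops θ).card := by
  have := count_edges hc hn
  have := count_max θ
  omega

lemma tops_pos {θ : Finset (ℕ × ℕ)} (h : θ.Nonempty) : 0 < (tops θ).card := by
  obtain ⟨a, ha, hm⟩ := Finset.exists_max_image θ cz h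
  refine Finset.card_pos.2 ⟨a, Finset.mem_filter.2 ⟨ha, ?_⟩⟩
  intro h
  obtain ⟨x, hx, hxa⟩ := Finset.mem_image.1 h
  have := hm x hx
  omega

lemma maxs_inj {θ : Finset (ℕ × ℕ)} (hc : Conv θ) (hn : NSq θ) : Set.InjOn cc (maxs θ : Set (ℕ × ℕ)) := by
  intro a ha b hb h
  exact inj_of_nsq hc hn (Finset.mem_filter.1 ha).1 (Finset.mem_filter.1 hb).1 (cc_inj_iff.1 h)

open Polynomial in
lemma sum_GG {θ : Finset (ℕ × ℕ)} (hc : Conv θ) (hne : θ.Nonempty) (v : ℂ)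
    (hv : ∀ b ∈ maxs θ, v ≠ cc b) :
    GG θ v = ∑ b ∈ maxs θ, GG (θ.erase b) (cc b) * (v - cc b)⁻¹ := by
  by_cases hn : NSq θ
  swap
  · rw [GG, if_neg hn]
    symm
    apply Finset.sum_eq_zero
    intro b hb
    rw [GG_erase_sq hc hn hb, zero_mul]
  have hdeg : (Lagrange.nodal (meets θ) cc).degree < (maxs θ).card := by
    rw [Lagrange.degree_nodal, card_maxs hc hn]
    have := tops_pos hne
    exact_mod_cast (by omega)
  have h1 := Lagrange.eval_interpolate_not_at_node (s := maxs θ) (v := cc) (x := v)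
    (fun i => eval (cc i) (Lagrange.nodal (meets θ) cc)) hv
  rw [← Lagrange.eq_interpolate (maxs_inj hc hn) hdeg] at h1
  have h0 : eval v (Lagrange.nodal (maxs θ) cc) ≠ 0 := Lagrange.eval_nodal_not_at_node hv
  rw [GG, if_pos hn, prod_phi, ← Lagrange.eval_nodal, ← Lagrange.eval_nodal, h1,
    mul_div_cancel_left₀ _ h0, Finset.mul_sum]
  apply Finset.sum_congr rfl
  intro b hb
  rw [GG_erase_nsq hn hb, prod_phi_erase hb, Lagrange.nodalWeight, Lagrange.eval_nodal,
    Finset.prod_inv_distrib]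
  ring

lemma rows_card {θ : Finset (ℕ × ℕ)} (hc : Conv θ) :
    (θ.image Prod.fst).card + (θ.filter (fun a => rt a ∈ θ)).card = θ.card := by
  have : θ.image Prod.fst = (θ.filter (fun a => ¬ rt a ∈ θ)).image Prod.fst := by
    ext r
    constructor
    · intro h
      obtain ⟨a, ha, rfl⟩ := Finset.mem_image.1 h
      obtain ⟨b, hb, hm⟩ := Finset.exists_max_image (θ.filter (fun x => x.1 = a.1)) Prod.snd
        ⟨a, Finset.mem_filter.2 ⟨ha, rfl⟩⟩
      obtain ⟨hb, hba⟩ := Finset.mem_filter.1 hb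
      refine Finset.mem_image.2 ⟨b, Finset.mem_filter.2 ⟨hb, fun h => ?_⟩, hba⟩
      have := hm _ (Finset.mem_filter.2 ⟨h, hba⟩)
      simp [rt] at this
    · intro h
      obtain ⟨a, ha, rfl⟩ := Finset.mem_image.1 h
      exact Finset.mem_image.2 ⟨a, (Finset.mem_filter.1 ha).1, rfl⟩
  rw [this, Finset.card_image_of_injOn, add_comm]
  · exact Finset.card_filter_add_card_filter_not _
  · intro a ha b hb h
    obtain ⟨ha, ha'⟩ := Finset.mem_filter.1 ha
    obtain ⟨hb, hb'⟩ := Finset.mem_filter.1 hb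
    change a.1 = b.1 at h
    rcases lt_trichotomy a.2 b.2 with h1 | h1 | h1
    · exact absurd (hc a ha b hb _ (by simp [rt]) (by simp [rt]) (by simp [rt]; omega) (by simp [rt]; omega)) ha'
    · exact Prod.ext h h1
    · exact absurd (hc b hb a ha _ (by simp [rt]) (by simp [rt]) (by simp [rt]; omega) (by simp [rt]; omega)) hb'

lemma hook_iff {θ : Finset (ℕ × ℕ)} (hc : Conv θ) (hne : θ.Nonempty) (hn : NSq θ) :
    IsSkewHook θ ↔ (tops θ).card = 1 := by
  have hinj : Set.InjOn cz (θ : Set (ℕ × ℕ)) := fun a ha b hb h => inj_of_nsq hc hn ha hb h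
  have hcard : (θ.image cz).card = θ.card := Finset.card_image_of_injOn hinj
  have hco : contentsOf θ = θ.image cz := rfl
  constructor
  · rintro ⟨_, _, x, hx⟩
    rw [hco] at hx
    have h1 := tops_pos hne
    have h2 : (tops θ).card ≤ 1 := by
      rw [Finset.card_le_one]
      intro a ha b hb
      obtain ⟨ha, ha'⟩ := Finset.mem_filter.1 ha
      obtain ⟨hb, hb'⟩ := Finset.mem_filter.1 hb
      have hA := Finset.mem_image_of_mem cz ha
      have hB := Finset.mem_image_of_mem cz hb
      rw [hx] at ha' hb' hA hB
      simp only [Finset.mem_image, Finset.mem_range, not_exists, not_and] at ha' hb' hA hB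
      obtain ⟨i, hi, hi'⟩ := hA
      obtain ⟨j, hj, hj'⟩ := hB
      apply inj_of_nsq hc hn ha hb
      have h3 : ¬ (i + 1 < θ.card) := fun h => ha' (i + 1) h (by push_cast; omega)
      have h4 : ¬ (j + 1 < θ.card) := fun h => hb' (j + 1) h (by push_cast; omega)
      omega
    omega
  · intro h
    obtain ⟨t, ht⟩ := Finset.card_eq_one.1 h
    refine ⟨hne, hcard, ?_⟩
    rw [hco]
    obtain ⟨m, hm, hmin⟩ := Finset.exists_min_image θ cz hne
    refine ⟨cz m, ?_⟩
    obtain ⟨M, hM, hmax⟩ := Finset.exists_max_image θ cz hne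
    have hMt : M ∈ tops θ := by
      refine Finset.mem_filter.2 ⟨hM, fun h => ?_⟩
      obtain ⟨x, hx, hxa⟩ := Finset.mem_image.1 h
      have := hmax x hx
      omega
    have step : ∀ i : ℕ, cz m + i ≤ cz M → cz m + i ∈ θ.image cz := by
      intro i
      induction i with
      | zero => intro _; simpa using ⟨_, _, hm, rfl⟩
      | succ i ih =>
        intro hi
        obtain ⟨a, ha, haa⟩ := Finset.mem_image.1 (ih (by push_cast at hi; omega))
        by_contra hcon
        have : a ∈ tops θ := by
          refine Finset.mem_filter.2 ⟨ha, ?_⟩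
          rw [haa]; push_cast at hcon; rwa [add_assoc]
        have : a = M := by
          rw [ht, Finset.mem_singleton] at this hMt
          rw [this, hMt]
        subst this
        push_cast at hi
        omega
    have hIcc : θ.image cz = Finset.Icc (cz m) (cz M) := by
      ext x
      rw [Finset.mem_Icc]
      constructor
      · intro hx
        obtain ⟨a, ha, rfl⟩ := Finset.mem_image.1 hx
        exact ⟨hmin a ha, hmax a ha⟩
      · rintro ⟨h1, h2⟩
        have := step (x - cz m).toNat (by omega)
        rwa [show cz m + ((x - cz m).toNat : ℤ) = x by omega] at this
    have hc2 : (θ.card : ℤ) = cz M + 1 - cz m := by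
      rw [← hcard, hIcc, Int.card_Icc]
      have := hmin M hM
      omega
    rw [hIcc]
    ext x
    simp only [Finset.mem_Icc, Finset.mem_image, Finset.mem_range]
    constructor
    · rintro ⟨h1, h2⟩
      exact ⟨(x - cz m).toNat, by omega, by omega⟩
    · rintro ⟨i, hi, rfl⟩
      omega

lemma nsq_of_hook {θ : Finset (ℕ × ℕ)} (h : IsSkewHook θ) : NSq θ := by
  intro a ha hd
  have h2 : Set.InjOn cz (θ : Set (ℕ × ℕ)) := Finset.card_image_iff.1 h.2.1
  have := h2 ha hd (by simp [cz, dg])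
  have := congrArg Prod.fst this
  simp [dg] at this

open scoped Classical in
noncomputable def hookVal (θ : Finset (ℕ × ℕ)) : ℂ := if IsSkewHook θ then (-1) ^ skewL θ else 0

open Polynomial in
lemma sum_GG_hook {θ : Finset (ℕ × ℕ)} (hc : Conv θ) (hne : θ.Nonempty) :
    ∑ b ∈ maxs θ, GG (θ.erase b) (cc b) = hookVal θ := by
  by_cases hn : NSq θ
  swap
  · rw [hookVal, if_neg (fun h => hn (nsq_of_hook h))]
    apply Finset.sum_eq_zero
    intro b hb
    rw [GG_erase_sq hc hn hb]
  have htp := tops_pos hne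
  have hcm := card_maxs hc hn
  have hdeg : (Lagrange.nodal (meets θ) cc).degree < (maxs θ).card := by
    rw [Lagrange.degree_nodal, card_maxs hc hn]
    exact_mod_cast (by omega)
  have h1 := Lagrange.coeff_eq_sum (maxs_inj hc hn) hdeg
  have h2 : ∑ b ∈ maxs θ, GG (θ.erase b) (cc b) = sg θ *
      (Lagrange.nodal (meets θ) cc).coeff ((maxs θ).card - 1) := by
    rw [h1, Finset.mul_sum]
    apply Finset.sum_congr rfl
    intro b hb
    rw [GG_erase_nsq hn hb, prod_phi_erase hb, Lagrange.eval_nodal]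
  rw [h2, hookVal]
  split_ifs with hh
  · rw [hook_iff hc hne hn] at hh
    have h3 : (maxs θ).card - 1 = (Lagrange.nodal (meets θ) cc).natDegree := by
      rw [Lagrange.natDegree_nodal]; omega
    rw [h3, Polynomial.coeff_natDegree, Lagrange.nodal_monic, mul_one, sg, skewL]
    congr 1
    have := rows_card hc
    have := count_edges hc hn
    omega
  · rw [hook_iff hc hne hn] at hh
    rw [Polynomial.coeff_eq_zero_of_natDegree_lt, mul_zero]
    rw [Lagrange.natDegree_nodal]; omega

end MN

namespace MN

def del (lam : YoungDiagram) (b : ℕ × ℕ) : YoungDiagram :=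
  if h : b ∈ maxs lam.cells then
    ⟨lam.cells.erase b, by
      intro x y hyx hx
      simp only [Finset.coe_erase, Set.mem_diff, Finset.mem_coe, Set.mem_singleton_iff] at hx ⊢
      refine ⟨lam.isLowerSet hyx hx.1, ?_⟩
      rintro rfl
      obtain ⟨h0, h1, h2⟩ := Finset.mem_filter.1 h
      obtain ⟨hx, hne⟩ := hx
      obtain ⟨h3, h4⟩ := Prod.le_def.1 hyx
      by_cases h5 : y.1 < x.1
      · exact h2 (lam.isLowerSet (show dn y ≤ x from Prod.le_def.2 ⟨by simp [dn]; omega, by simp [dn]; omega⟩) hx)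
      · by_cases h6 : y.2 < x.2
        · exact h1 (lam.isLowerSet (show rt y ≤ x from Prod.le_def.2 ⟨by simp [rt]; omega, by simp [rt]; omega⟩) hx)
        · exact hne (Prod.ext (by omega) (by omega))⟩
  else lam

lemma cells_del {lam : YoungDiagram} {b : ℕ × ℕ} (h : b ∈ maxs lam.cells) :
    (del lam b).cells = lam.cells.erase b := by
  simp [del, h]

lemma card_del {lam : YoungDiagram} {b : ℕ × ℕ} (h : b ∈ maxs lam.cells) :
    (del lam b).card + 1 = lam.card := by
  rw [YoungDiagram.card, cells_del h]
  exact Finset.card_erase_add_one (Finset.mem_filter.1 h).1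

open scoped Classical in
noncomputable def Z (D : Finset ℕ) : ℕ → YoungDiagram → ℂ → ℂ
  | 0, lam, _ => if lam = ⊥ then 1 else 0
  | n + 1, lam, v => ∑ b ∈ maxs lam.cells,
      Z D n (del lam b) (cc b) * (if n ∈ D then (v - cc b)⁻¹ else 1)

lemma Z_indep {D : Finset ℕ} {n : ℕ} (h : ∀ k, k + 1 = n → k ∉ D) (lam : YoungDiagram) (v w : ℂ) :
    Z D n lam v = Z D n lam w := by
  cases n with
  | zero => rfl
  | succ n => simp [Z, h n rfl]

lemma Z_congr {D D' : Finset ℕ} {n : ℕ} (h : ∀ k, k < n → (k ∈ D ↔ k ∈ D')) (lam : YoungDiagram) (v : ℂ) :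
    Z D n lam v = Z D' n lam v := by
  induction n generalizing lam v with
  | zero => rfl
  | succ n ih =>
    simp only [Z]
    apply Finset.sum_congr rfl
    intro b _
    rw [ih (fun k hk => h k (by omega))]
    simp only [h n (by omega)]

lemma conv_skew (lam mu : YoungDiagram) : Conv (lam.cells \ mu.cells) := by
  intro a ha b hb x h1 h2 h3 h4
  simp only [Finset.mem_sdiff] at *
  exact ⟨lam.isLowerSet (show x ≤ b from Prod.le_def.2 ⟨h3, h4⟩) hb.1,
    fun h => ha.2 (mu.isLowerSet (show a ≤ x from Prod.le_def.2 ⟨h1, h2⟩) h)⟩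

lemma maxs_skew (lam mu : YoungDiagram) :
    maxs (lam.cells \ mu.cells) = (maxs lam.cells).filter (fun b => b ∉ mu.cells) := by
  ext b
  have hr : rt b ∈ mu.cells → b ∈ mu.cells := fun h =>
    mu.isLowerSet (show b ≤ rt b from Prod.le_def.2 ⟨by simp [rt], by simp [rt]⟩) h
  have hd : dn b ∈ mu.cells → b ∈ mu.cells := fun h =>
    mu.isLowerSet (show b ≤ dn b from Prod.le_def.2 ⟨by simp [dn], by simp [dn]⟩) h
  simp only [maxs, Finset.mem_filter, Finset.mem_sdiff]
  tauto

lemma finite_lower (lam : YoungDiagram) : {mu : YoungDiagram | mu ≤ lam}.Finite := by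
  apply Set.Finite.of_finite_image (f := YoungDiagram.cells)
  · apply (Finset.finite_toSet lam.cells.powerset).subset
    rintro _ ⟨mu, hmu, rfl⟩
    simpa using YoungDiagram.cells_subset_iff.2 hmu
  · intro a _ b _ h
    exact YoungDiagram.ext h

noncomputable def lowerF (lam : YoungDiagram) : Finset YoungDiagram := (finite_lower lam).toFinset

noncomputable def lower (lam : YoungDiagram) (N : ℕ) : Finset YoungDiagram :=
  (lowerF lam).filter (fun mu => mu.card = N)

lemma mem_lowerF {lam mu : YoungDiagram} : mu ∈ lowerF lam ↔ mu ≤ lam := by simp [lowerF]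

lemma mem_lower {lam mu : YoungDiagram} {N : ℕ} : mu ∈ lower lam N ↔ mu ≤ lam ∧ mu.card = N := by
  simp [lower, mem_lowerF]

lemma mem_lower_del {lam mu : YoungDiagram} {N : ℕ} {b : ℕ × ℕ} (h : b ∈ maxs lam.cells) :
    mu ∈ lower (del lam b) N ↔ mu ∈ lower lam N ∧ b ∉ mu.cells := by
  rw [mem_lower, mem_lower, ← YoungDiagram.cells_subset_iff, ← YoungDiagram.cells_subset_iff, cells_del h,
    Finset.subset_erase]
  tauto

lemma sum_swap (lam : YoungDiagram) (N : ℕ) (F : YoungDiagram → ℕ × ℕ → ℂ) :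
    ∑ b ∈ maxs lam.cells, ∑ mu ∈ lower (del lam b) N, F mu b =
      ∑ mu ∈ lower lam N, ∑ b ∈ maxs (lam.cells \ mu.cells), F mu b := by
  apply Finset.sum_comm'
  intro b mu
  rw [maxs_skew, Finset.mem_filter]
  constructor
  · rintro ⟨h1, h2⟩
    rw [mem_lower_del h1] at h2
    tauto
  · rintro ⟨⟨h1, h2⟩, h3⟩
    exact ⟨h1, (mem_lower_del h1).2 ⟨h3, h2⟩⟩

lemma cc_ne {lam : YoungDiagram} {b b' : ℕ × ℕ} (h : b ∈ maxs lam.cells)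
    (h' : b' ∈ maxs (del lam b).cells) : cc b ≠ cc b' := by
  rw [cells_del h] at h'
  obtain ⟨h0, h1, h2⟩ := Finset.mem_filter.1 h
  obtain ⟨h0', h1', h2'⟩ := Finset.mem_filter.1 h'
  simp only [Finset.mem_erase, not_and] at h0' h1' h2'
  rw [Ne, cc_inj_iff]
  unfold cz
  intro hc
  rcases lt_trichotomy b'.1 b.1 with h3 | h3 | h3
  · refine h2' ?_ (lam.isLowerSet (show dn b' ≤ b from Prod.le_def.2 ⟨by simp [dn]; omega, by simp [dn]; omega⟩) h0)
    intro h4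
    have := congrArg Prod.snd h4
    simp [dn] at this
    omega
  · exact h0'.1 (Prod.ext h3 (by omega))
  · exact h2 (lam.isLowerSet (show dn b ≤ b' from Prod.le_def.2 ⟨by simp [dn]; omega, by simp [dn]; omega⟩) h0'.2)

lemma skew_del {lam mu : YoungDiagram} {b : ℕ × ℕ} (h : b ∈ maxs lam.cells) :
    (del lam b).cells \ mu.cells = (lam.cells \ mu.cells).erase b := by
  rw [cells_del h]
  ext x
  simp only [Finset.mem_sdiff, Finset.mem_erase]
  tauto

lemma skew_nonempty {lam mu : YoungDiagram} (h : mu.card < lam.card) :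
    (lam.cells \ mu.cells).Nonempty := by
  rw [Finset.sdiff_nonempty]
  intro h'
  exact absurd (Finset.card_le_card h') (by simpa using h)

lemma block1 {D : Finset ℕ} {N m : ℕ} (h0 : ∀ k, k + 1 = N → k ∉ D)
    (hD : ∀ i, i + 1 < m → N + i ∈ D) (j : ℕ) (hj : j < m) (lam : YoungDiagram)
    (hl : lam.card = N + j) (v : ℂ) (hv : ∀ b ∈ maxs lam.cells, v ≠ cc b) :
    Z D (N + j) lam v = ∑ mu ∈ lower lam N, Z D N mu 0 * GG (lam.cells \ mu.cells) v := by
  induction j generalizing lam v with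
  | zero =>
    have : lower lam N = {lam} := by
      ext mu
      rw [mem_lower, Finset.mem_singleton]
      constructor
      · rintro ⟨h1, h2⟩
        apply YoungDiagram.ext
        exact Finset.eq_of_subset_of_card_le (YoungDiagram.cells_subset_iff.2 h1) (by
          change lam.card ≤ mu.card; omega)
      · rintro rfl; exact ⟨le_rfl, by omega⟩
    rw [this, Finset.sum_singleton, Finset.sdiff_self, GG_empty, mul_one]
    exact Z_indep h0 _ _ _
  | succ j ih =>
    have step : Z D (N + (j + 1)) lam v = ∑ b ∈ maxs lam.cells, ∑ mu ∈ lower (del lam b) N,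
        Z D N mu 0 * (GG ((lam.cells \ mu.cells).erase b) (cc b) * (v - cc b)⁻¹) := by
      rw [← add_assoc, Z]
      apply Finset.sum_congr rfl
      intro b hb
      have := card_del hb
      rw [if_pos (hD j hj), ih (by omega) _ (by omega) _ (fun b' hb' => cc_ne hb hb'), Finset.sum_mul]
      apply Finset.sum_congr rfl
      intro mu _
      rw [skew_del hb, mul_assoc]
    rw [step, sum_swap]
    apply Finset.sum_congr rfl
    intro mu hmu
    rw [mem_lower] at hmu
    rw [← Finset.mul_sum, sum_GG (conv_skew _ _) (skew_nonempty (by omega))]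
    intro b hb
    rw [maxs_skew, Finset.mem_filter] at hb
    exact hv b hb.1

lemma block2 {D : Finset ℕ} {N m : ℕ} (h0 : ∀ k, k + 1 = N → k ∉ D)
    (hD : ∀ i, i < m → N + i ∈ D) (hD' : N + m ∉ D) (lam : YoungDiagram)
    (hl : lam.card = N + m + 1) (v : ℂ) :
    Z D (N + m + 1) lam v = ∑ mu ∈ lower lam N, Z D N mu 0 * hookVal (lam.cells \ mu.cells) := by
  have step : Z D (N + m + 1) lam v = ∑ b ∈ maxs lam.cells, ∑ mu ∈ lower (del lam b) N,
      Z D N mu 0 * (GG ((lam.cells \ mu.cells).erase b) (cc b)) := by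
    rw [Z]
    apply Finset.sum_congr rfl
    intro b hb
    have := card_del hb
    rw [if_neg hD', mul_one, block1 (m := m + 1) h0 (fun i hi => hD i (by omega)) m (by omega) _ (by omega) _
      (fun b' hb' => cc_ne hb hb')]
    apply Finset.sum_congr rfl
    intro mu _
    rw [skew_del hb]
  rw [step, sum_swap]
  apply Finset.sum_congr rfl
  intro mu hmu
  rw [mem_lower] at hmu
  rw [← Finset.mul_sum, sum_GG_hook (conv_skew _ _) (skew_nonempty (by omega))]

open scoped Classical in
noncomputable def RR (l : ℕ) (ρ : Fin l → ℕ) (μ : YoungDiagram) : ℂ :=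
  ∑ᶠ H : Fin (l + 1) → YoungDiagram,
        if H 0 = ⊥ ∧ H (Fin.last l) = μ ∧
            (∀ i : Fin l, hookStep (ρ i) (H i.castSucc) (H i.succ)) then
          (-1 : ℂ) ^ (∑ i : Fin l, skewL ((H i.succ).cells \ (H i.castSucc).cells))
        else 0

lemma RR_zero (ρ : Fin 0 → ℕ) (μ : YoungDiagram) [Decidable (μ = ⊥)] :
    RR 0 ρ μ = if μ = ⊥ then 1 else 0 := by
  classical
  rw [RR, finsum_eq_single _ (fun _ => μ)]
  · simp
  · intro H hH
    rw [if_neg]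
    rintro ⟨h1, h2, -⟩
    apply hH
    ext1 i
    rw [show i = Fin.last 0 from Fin.ext (by simp), h2]

/-- Admissible chains. -/
def chains (l : ℕ) (ρ : Fin l → ℕ) (μ : YoungDiagram) : Set (Fin (l + 1) → YoungDiagram) :=
  {H | H 0 = ⊥ ∧ H (Fin.last l) = μ ∧
            (∀ i : Fin l, hookStep (ρ i) (H i.castSucc) (H i.succ))}

lemma chains_le {l : ℕ} {ρ : Fin l → ℕ} {μ : YoungDiagram} {H : Fin (l + 1) → YoungDiagram}
    (h : H ∈ chains l ρ μ) (i : Fin (l + 1)) : H i ≤ μ := by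
  have hm : Monotone H := Fin.monotone_iff_le_succ.2 (fun i => (h.2.2 i).1)
  rw [← h.2.1]
  exact hm (Fin.le_last i)

lemma chains_finite (l : ℕ) (ρ : Fin l → ℕ) (μ : YoungDiagram) : (chains l ρ μ).Finite := by
  apply (Set.Finite.pi' (fun _ : Fin (l + 1) => finite_lower μ)).subset
  intro H h i
  exact chains_le h i

noncomputable def chainsF (l : ℕ) (ρ : Fin l → ℕ) (μ : YoungDiagram) :
    Finset (Fin (l + 1) → YoungDiagram) := (chains_finite l ρ μ).toFinset

lemma mem_chainsF {l : ℕ} {ρ : Fin l → ℕ} {μ : YoungDiagram} {H : Fin (l + 1) → YoungDiagram} :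
    H ∈ chainsF l ρ μ ↔ H 0 = ⊥ ∧ H (Fin.last l) = μ ∧
            (∀ i : Fin l, hookStep (ρ i) (H i.castSucc) (H i.succ)) := by
  simp [chainsF, chains]

lemma RR_eq (l : ℕ) (ρ : Fin l → ℕ) (μ : YoungDiagram) :
    RR l ρ μ = ∑ H ∈ chainsF l ρ μ,
      (-1 : ℂ) ^ (∑ i : Fin l, skewL ((H i.succ).cells \ (H i.castSucc).cells)) := by
  classical
  rw [RR, finsum_eq_sum_of_support_subset (s := chainsF l ρ μ)]
  · apply Finset.sum_congr rfl
    intro H hH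
    rw [mem_chainsF] at hH
    rw [if_pos hH]
  · intro H hH
    rw [Function.mem_support] at hH
    rw [Finset.mem_coe, mem_chainsF]
    by_contra hcon
    exact hH (if_neg hcon)

open scoped Classical in
lemma RR_succ (l : ℕ) (ρ : Fin (l + 1) → ℕ) (μ : YoungDiagram) :
    RR (l + 1) ρ μ = ∑ ν ∈ (lowerF μ).filter (fun ν => hookStep (ρ (Fin.last l)) ν μ),
      RR l (fun i => ρ i.castSucc) ν * (-1) ^ skewL (μ.cells \ ν.cells) := by
  simp only [RR_eq, Finset.sum_mul]
  rw [Finset.sum_sigma']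
  symm
  apply Finset.sum_bij (fun (x : Σ _ : YoungDiagram, Fin (l + 1) → YoungDiagram) _ =>
      (Fin.snoc x.2 μ : Fin (l + 2) → YoungDiagram))
  · rintro ⟨ν, H⟩ hx
    simp only [Finset.mem_sigma, Finset.mem_filter, mem_chainsF] at hx
    obtain ⟨⟨h1, h2⟩, h3, h4, h5⟩ := hx
    rw [mem_chainsF]
    refine ⟨?_, by simp, ?_⟩
    · rw [← Fin.castSucc_zero, Fin.snoc_castSucc]; exact h3
    · intro i
      refine Fin.lastCases ?_ (fun i => ?_) i
      · simpa [h4] using h2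
      · rw [← Fin.castSucc_succ]
        simp only [Fin.snoc_castSucc]
        exact h5 i
  · rintro ⟨ν, H⟩ hx ⟨ν', H'⟩ hx' h
    simp only [Finset.mem_sigma, Finset.mem_filter, mem_chainsF] at hx hx'
    have h1 := (Fin.snoc_inj.1 h).1
    simp only at h1
    subst h1
    have : ν = ν' := hx.2.2.1.symm.trans hx'.2.2.1
    rw [this]
  · intro H hH
    rw [mem_chainsF] at hH
    obtain ⟨h1, h2, h3⟩ := hH
    refine ⟨⟨H (Fin.last l).castSucc, fun i => H i.castSucc⟩, ?_, ?_⟩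
    · simp only [Finset.mem_sigma, Finset.mem_filter, mem_chainsF, mem_lowerF]
      have := h3 (Fin.last l)
      rw [Fin.succ_last, h2] at this
      refine ⟨⟨this.1, this⟩, by simpa using h1, trivial, fun i => ?_⟩
      have := h3 i.castSucc
      rwa [← Fin.castSucc_succ] at this
    · simp only [← h2]
      exact Fin.snoc_init_self H
  · rintro ⟨ν, H⟩ hx
    simp only [Finset.mem_sigma, Finset.mem_filter, mem_chainsF] at hx
    rw [Fin.sum_univ_castSucc, pow_add]
    simp [← Fin.castSucc_succ, hx.2.2.1]

/-- The list of descents inside blocks. -/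
def ks : (l : ℕ) → (Fin l → ℕ) → List ℕ
  | 0, _ => []
  | l + 1, ρ => ks l (fun i => ρ i.castSucc) ++
      (List.range (ρ (Fin.last l) - 1)).map (fun i => (∑ j : Fin l, ρ j.castSucc) + i)

lemma ks_lt : ∀ (l : ℕ) (ρ : Fin l → ℕ) (k : ℕ), k ∈ ks l ρ → k + 1 < ∑ i, ρ i := by
  intro l
  induction l with
  | zero => intro ρ k h; simp [ks] at h
  | succ l ih =>
    intro ρ k h
    rw [Fin.sum_univ_castSucc]
    simp only [ks, List.mem_append, List.mem_map, List.mem_range] at h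
    rcases h with h | ⟨i, hi, rfl⟩
    · have := ih _ k h
      omega
    · omega

lemma ks_nodup : ∀ (l : ℕ) (ρ : Fin l → ℕ), (ks l ρ).Nodup := by
  intro l
  induction l with
  | zero => intro ρ; simp [ks]
  | succ l ih =>
    intro ρ
    simp only [ks]
    rw [List.nodup_append']
    refine ⟨ih _, List.Nodup.map (fun a b h => by simpa using h) List.nodup_range, ?_⟩
    intro k hk hk'
    have := ks_lt _ _ k hk
    simp only [List.mem_map, List.mem_range] at hk'
    obtain ⟨i, hi, rfl⟩ := hk'
    omega

lemma Z_eq_RR : ∀ (l : ℕ) (ρ : Fin l → ℕ) (_ : ∀ i, 0 < ρ i) (lam : YoungDiagram)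
    (_ : lam.card = ∑ i, ρ i) (v : ℂ), Z (ks l ρ).toFinset (∑ i, ρ i) lam v = RR l ρ lam := by
  intro l
  induction l with
  | zero =>
    intro ρ _ lam _ v
    classical
    rw [RR_zero]
    simp [Z]
  | succ l ih =>
    intro ρ hp lam hl v
    classical
    obtain ⟨m, hm⟩ : ∃ m, ρ (Fin.last l) = m + 1 := ⟨ρ (Fin.last l) - 1, by have := hp (Fin.last l); omega⟩
    have hlt := ks_lt l (fun i => ρ i.castSucc)
    rw [Fin.sum_univ_castSucc, hm] at hl ⊢
    rw [← add_assoc] at hl ⊢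
    rw [block2 (m := m) _ _ _ _ hl, RR_succ, Finset.sum_filter, lower, Finset.sum_filter]
    · apply Finset.sum_congr rfl
      intro ν hν
      rw [mem_lowerF] at hν
      have hcard : (lam.cells \ ν.cells).card + ν.card = lam.card :=
        Finset.card_sdiff_add_card_eq_card (YoungDiagram.cells_subset_iff.2 hν)
      by_cases h1 : ν.card = ∑ i : Fin l, ρ i.castSucc
      · rw [if_pos h1]
        have e : Z (ks (l + 1) ρ).toFinset (∑ i : Fin l, ρ i.castSucc) ν 0 =
            RR l (fun i => ρ i.castSucc) ν := by
          rw [← ih _ (fun i => hp _) ν h1 0]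
          apply Z_congr
          intro k hk
          simp only [ks, List.toFinset_append, Finset.mem_union, List.mem_toFinset, List.mem_map]
          constructor
          · rintro (h | ⟨i, hi, rfl⟩)
            · exact h
            · omega
          · exact Or.inl
        rw [e]
        have h2 : hookStep (ρ (Fin.last l)) ν lam ↔ IsSkewHook (lam.cells \ ν.cells) := by
          simp only [hookStep, hν, true_and, and_iff_right_iff_imp]
          intro _
          omega
        simp only [hookVal, h2]
        split_ifs <;> simp
      · rw [if_neg h1, if_neg]
        rintro ⟨_, h3, _⟩
        omega
    · intro k hk h
      simp only [ks, List.toFinset_append, Finset.mem_union, List.mem_toFinset, List.mem_map] at h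
      rcases h with h | ⟨i, hi, rfl⟩
      · have := hlt k h
        omega
      · omega
    · intro i hi
      simp only [ks, List.toFinset_append, Finset.mem_union, List.mem_toFinset, List.mem_map, List.mem_range]
      exact Or.inr ⟨i, by omega, rfl⟩
    · intro h
      simp only [ks, List.toFinset_append, Finset.mem_union, List.mem_toFinset, List.mem_map, List.mem_range] at h
      rcases h with h | ⟨i, hi, h⟩
      · have := hlt _ h
        omega
      · omega

end MN

namespace MN

lemma syt_finite (lam : YoungDiagram) (n : ℕ) : {T : Fin n → ℕ × ℕ | IsStandardTableau lam n T}.Finite := by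
  apply (Set.Finite.pi' (fun _ : Fin n => Finset.finite_toSet lam.cells)).subset
  intro T hT i
  rw [← hT.2.1]
  exact ⟨i, rfl⟩

noncomputable def sytF (lam : YoungDiagram) (n : ℕ) : Finset (Fin n → ℕ × ℕ) :=
  (syt_finite lam n).toFinset

lemma mem_sytF {lam : YoungDiagram} {n : ℕ} {T : Fin n → ℕ × ℕ} :
    T ∈ sytF lam n ↔ IsStandardTableau lam n T := by simp [sytF]

/-- the box `y` is adjacent to the right or below `x` -/
def Adj (x y : ℕ × ℕ) : Prop := (y.1 = x.1 ∧ y.2 = x.2 + 1) ∨ (y.1 = x.1 + 1 ∧ y.2 = x.2)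

lemma adj_iff {x y : ℕ × ℕ} : Adj x y ↔ y = rt x ∨ y = dn x := by
  simp [Adj, rt, dn, Prod.ext_iff]

lemma std_snoc {lam : YoungDiagram} {n : ℕ} {T : Fin n → ℕ × ℕ} {b : ℕ × ℕ} (hb : b ∈ maxs lam.cells)
    (hT : IsStandardTableau (del lam b) n T) :
    IsStandardTableau lam (n + 1) (Fin.snoc T b : Fin (n + 1) → ℕ × ℕ) := by
  obtain ⟨h1, h2, h3⟩ := hT
  rw [cells_del hb] at h2
  obtain ⟨hb0, hb1, hb2⟩ := Finset.mem_filter.1 hb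
  refine ⟨?_, ?_, ?_⟩
  · rw [Fin.snoc_injective_iff]
    refine ⟨h1, ?_⟩
    rw [h2]; simp
  · rw [Fin.range_snoc, h2, ← Finset.coe_insert, Finset.insert_erase hb0]
  · intro j k
    refine Fin.lastCases ?_ (fun j => ?_) j <;> refine Fin.lastCases ?_ (fun k => ?_) k
    · intro h
      simp at h
    · simp only [Fin.snoc_castSucc, Fin.snoc_last]
      intro h
      exfalso
      have hk : T k ∈ lam.cells.erase b := by
        rw [← Finset.mem_coe, ← h2]; exact ⟨k, rfl⟩
      have hk := Finset.mem_of_mem_erase hk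
      rcases adj_iff.1 h with h | h <;> rw [h] at hk
      · exact hb1 hk
      · exact hb2 hk
    · intro _
      exact Fin.castSucc_lt_last j
    · simp only [Fin.snoc_castSucc]
      intro h
      exact Fin.castSucc_lt_castSucc_iff.2 (h3 j k h)

lemma std_last {lam : YoungDiagram} {n : ℕ} {T : Fin (n + 1) → ℕ × ℕ}
    (hT : IsStandardTableau lam (n + 1) T) : T (Fin.last n) ∈ maxs lam.cells := by
  obtain ⟨h1, h2, h3⟩ := hT
  have key : ∀ y, Adj (T (Fin.last n)) y → y ∉ lam.cells := by
    intro y hy hy'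
    rw [← Finset.mem_coe, ← h2] at hy'
    obtain ⟨k, rfl⟩ := hy'
    exact absurd (h3 _ k hy) (not_lt.2 (Fin.le_last k))
  refine Finset.mem_filter.2 ⟨?_, key _ (adj_iff.2 (Or.inl rfl)), key _ (adj_iff.2 (Or.inr rfl))⟩
  rw [← Finset.mem_coe, ← h2]
  exact ⟨_, rfl⟩

lemma std_init {lam : YoungDiagram} {n : ℕ} {T : Fin (n + 1) → ℕ × ℕ}
    (hT : IsStandardTableau lam (n + 1) T) :
    IsStandardTableau (del lam (T (Fin.last n))) n (fun i => T i.castSucc) := by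
  have hl := std_last hT
  obtain ⟨h1, h2, h3⟩ := hT
  refine ⟨fun i j h => Fin.castSucc_injective _ (h1 h), ?_, ?_⟩
  · rw [cells_del hl]
    ext x
    simp only [Set.mem_range, Finset.coe_erase, Set.mem_diff, Set.mem_singleton_iff, ← h2]
    constructor
    · rintro ⟨i, rfl⟩
      exact ⟨⟨_, rfl⟩, fun h => (Fin.castSucc_lt_last i).ne (h1 h)⟩
    · rintro ⟨⟨k, rfl⟩, hk⟩
      revert hk
      refine Fin.lastCases ?_ (fun k => ?_) k
      · intro h; exact absurd rfl h
      · intro _; exact ⟨k, rfl⟩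
  · intro j k h
    exact Fin.castSucc_lt_castSucc_iff.1 (h3 _ _ h)

noncomputable def ext' {n : ℕ} (T : Fin n → ℕ × ℕ) (v : ℂ) : Fin (n + 1) → ℂ :=
  Fin.snoc (fun i => cc (T i)) v

noncomputable def wt (D : Finset ℕ) {n : ℕ} (T : Fin n → ℕ × ℕ) (v : ℂ) : ℂ :=
  ∏ k : Fin n, if (k : ℕ) ∈ D then (ext' T v k.succ - ext' T v k.castSucc)⁻¹ else 1

lemma ext'_castSucc {n : ℕ} (T : Fin n → ℕ × ℕ) (v : ℂ) (k : Fin n) :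
    ext' T v k.castSucc = cc (T k) := by simp [ext']

lemma ext'_last {n : ℕ} (T : Fin n → ℕ × ℕ) (v : ℂ) :
    ext' T v (Fin.last n) = v := by simp [ext']

lemma ext'_snoc {n : ℕ} (T : Fin n → ℕ × ℕ) (b : ℕ × ℕ) (v : ℂ) (k : Fin (n + 1)) :
    ext' (Fin.snoc T b : Fin (n + 1) → ℕ × ℕ) v k.castSucc = ext' T (cc b) k := by
  rw [ext'_castSucc]
  refine Fin.lastCases ?_ (fun k => ?_) k
  · simp [ext']
  · simp [ext']

lemma wt_snoc (D : Finset ℕ) {n : ℕ} (T : Fin n → ℕ × ℕ) (b : ℕ × ℕ) (v : ℂ) :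
    wt D (Fin.snoc T b : Fin (n + 1) → ℕ × ℕ) v =
      wt D T (cc b) * (if n ∈ D then (v - cc b)⁻¹ else 1) := by
  rw [wt, Fin.prod_univ_castSucc, wt]
  congr 1
  · apply Finset.prod_congr rfl
    intro k _
    rw [← Fin.castSucc_succ, ext'_snoc, ext'_snoc, Fin.val_castSucc]
  · rw [Fin.succ_last, ext'_last, ext'_snoc, ext'_last, Fin.val_last]

lemma sum_wt (D : Finset ℕ) (n : ℕ) (lam : YoungDiagram) (v : ℂ) :
    ∑ T ∈ sytF lam n, wt D T v = Z D n lam v := by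
  induction n generalizing lam v with
  | zero =>
    classical
    rw [Z]
    split_ifs with h
    · subst h
      have : sytF (⊥ : YoungDiagram) 0 = {Fin.elim0} := by
        ext T
        rw [mem_sytF, Finset.mem_singleton]
        constructor
        · intro _; exact Subsingleton.elim _ _
        · intro _
          refine ⟨fun i => i.elim0, ?_, fun i => i.elim0⟩
          simp
      rw [this]
      simp [wt]
    · have : sytF lam 0 = ∅ := by
        ext T
        rw [mem_sytF]
        constructor
        · intro hT
          exfalso
          apply h
          have := hT.2.1
          apply YoungDiagram.ext
          rw [YoungDiagram.cells_bot, ← Finset.coe_eq_empty, ← this]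
          simp
        · intro h; simp at h
      rw [this]; simp
  | succ n ih =>
    rw [Z]
    simp only [← ih, Finset.sum_mul]
    rw [Finset.sum_sigma']
    symm
    apply Finset.sum_bij (fun (x : Σ _ : ℕ × ℕ, Fin n → ℕ × ℕ) _ =>
      (Fin.snoc x.2 x.1 : Fin (n + 1) → ℕ × ℕ))
    · rintro ⟨b, T⟩ hx
      simp only [Finset.mem_sigma, mem_sytF] at hx ⊢
      exact std_snoc hx.1 hx.2
    · rintro ⟨b, T⟩ hx ⟨b', T'⟩ hx' h
      obtain ⟨h1, h2⟩ := Fin.snoc_inj.1 h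
      simp only at h1 h2
      rw [h1, h2]
    · intro T hT
      rw [mem_sytF] at hT
      refine ⟨⟨T (Fin.last n), fun i => T i.castSucc⟩, ?_, Fin.snoc_init_self T⟩
      simp only [Finset.mem_sigma, mem_sytF]
      exact ⟨std_last hT, std_init hT⟩
    · rintro ⟨b, T⟩ hx
      rw [wt_snoc]

noncomputable def rhoN {n : ℕ} (T : Fin n → ℕ × ℕ) (k : ℕ) : ℂ :=
  if h : k + 1 < n then ((rhoCoef (⟨k, by omega⟩ : Fin n) ⟨k + 1, h⟩ T : ℝ) : ℂ) else 1

lemma wt_eq {D : Finset ℕ} {n : ℕ} (hD : ∀ k ∈ D, k + 1 < n) (T : Fin n → ℕ × ℕ) (v : ℂ) :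
    wt D T v = ∏ k ∈ D, rhoN T k := by
  have h1 : wt D T v = ∏ k : Fin n, (fun k : ℕ => if k ∈ D then rhoN T k else 1) k := by
    rw [wt]
    apply Finset.prod_congr rfl
    intro k _
    by_cases hk : (k : ℕ) ∈ D
    · have hk' := hD _ hk
      simp only [if_pos hk, rhoN, dif_pos hk']
      have e : k.succ = Fin.castSucc (⟨(k : ℕ) + 1, hk'⟩ : Fin n) := by
        ext; simp
      rw [e, ext'_castSucc, ext'_castSucc, rhoCoef]
      simp [cc, cz]
    · simp only [if_neg hk]
  rw [h1, Fin.prod_univ_eq_prod_range (fun k : ℕ => if k ∈ D then rhoN T k else 1) n,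
    ← Finset.prod_filter]
  apply Finset.prod_congr _ (fun _ _ => rfl)
  ext k
  simp only [Finset.mem_filter, Finset.mem_range]
  exact ⟨fun h => h.2, fun h => ⟨by have := hD k h; omega, h⟩⟩

def sw (n k : ℕ) : Equiv.Perm (Fin n) :=
  if h : k + 1 < n then Equiv.swap (⟨k, by omega⟩ : Fin n) ⟨k + 1, h⟩ else 1

section trace

variable {μ : YoungDiagram} {n : ℕ}
    {ρrep : Representation ℂ (Equiv.Perm (Fin n)) (YoungSpace μ n)}

lemma rep_sw (hρ : IsYoungOrthogonalRep μ n ρrep) {k : ℕ} (h : k + 1 < n) :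
    ρrep (sw n k) = youngOp μ n ⟨k, by omega⟩ ⟨k + 1, h⟩ := by
  rw [sw, dif_pos h]
  exact hρ _ _ rfl

def initSet (n k : ℕ) : Set (Fin n) := {i | (i : ℕ) ≤ k}

lemma image_swap_initSet {j k : ℕ} (hjk : j ≠ k) (h : j + 1 < n) (S : Fin n → ℕ × ℕ) :
    (S ∘ Equiv.swap (⟨j, by omega⟩ : Fin n) ⟨j + 1, h⟩) '' initSet n k = S '' initSet n k := by
  rw [Set.image_comp]
  congr 1
  have hsub : ∀ x ∈ initSet n k, Equiv.swap (⟨j, by omega⟩ : Fin n) ⟨j + 1, h⟩ x ∈ initSet n k := by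
    intro x hx
    simp only [initSet, Set.mem_setOf_eq] at hx ⊢
    rw [Equiv.swap_apply_def]
    split_ifs with h1 h2
    · rw [h1] at hx; simp at hx ⊢; omega
    · rw [h2] at hx; simp at hx ⊢; omega
    · exact hx
  apply Set.Subset.antisymm
  · rintro _ ⟨x, hx, rfl⟩
    exact hsub x hx
  · intro x hx
    exact ⟨_, hsub x hx, Equiv.swap_apply_self _ _ _⟩

lemma supp_prod (hρ : IsYoungOrthogonalRep μ n ρrep) (k : ℕ) (A : Set (ℕ × ℕ)) (L : List ℕ)
    (hL : ∀ j ∈ L, j + 1 < n) (hk : k ∉ L) (f : YoungSpace μ n)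
    (hf : ∀ S, f S ≠ 0 → S.val '' initSet n k = A) :
    ∀ S, ρrep ((L.map (sw n)).prod) f S ≠ 0 → S.val '' initSet n k = A := by
  induction L with
  | nil => simpa using hf
  | cons j L ih =>
    have ih' := ih (fun i hi => hL i (List.mem_cons_of_mem _ hi)) (fun h => hk (List.mem_cons_of_mem _ h))
    have hj : j + 1 < n := hL j List.mem_cons_self
    have hjk : j ≠ k := fun h => hk (h ▸ List.mem_cons_self)
    intro S hS
    rw [List.map_cons, List.prod_cons, map_mul, Module.End.mul_apply, rep_sw hρ hj] at hS
    by_contra hcon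
    apply hS
    set g := ρrep ((L.map (sw n)).prod) f with hg
    have h1 : g S = 0 := by
      by_contra h; exact hcon (ih' S h)
    simp only [youngOp, LinearMap.coe_mk, AddHom.coe_mk, h1, mul_zero, zero_add]
    split_ifs with h2
    · have h3 : g ⟨_, h2⟩ = 0 := by
        by_contra h
        have := ih' _ h
        rw [image_swap_initSet hjk hj] at this
        exact hcon this
      rw [h3, mul_zero]
    · rw [mul_zero]

open scoped Classical in
lemma diag_prod (hρ : IsYoungOrthogonalRep μ n ρrep) (L : List ℕ) (hnd : L.Nodup)
    (hL : ∀ j ∈ L, j + 1 < n) (T : {T : Fin n → ℕ × ℕ // IsStandardTableau μ n T}) :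
    ρrep ((L.map (sw n)).prod) (Pi.single T 1) T = (L.map (rhoN T.val)).prod := by
  induction L with
  | nil => simp
  | cons j L ih =>
    have hL' : ∀ i ∈ L, i + 1 < n := fun i hi => hL i (List.mem_cons_of_mem _ hi)
    have ih' := ih (List.nodup_cons.1 hnd).2 hL'
    have hj : j + 1 < n := hL j List.mem_cons_self
    rw [List.map_cons, List.prod_cons, map_mul, Module.End.mul_apply, rep_sw hρ hj,
      List.map_cons, List.prod_cons, ← ih']
    have hs := supp_prod hρ j (T.val '' initSet n j) L hL' (List.nodup_cons.1 hnd).1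
      (Pi.single T 1) (fun S hS => by
        by_cases h : S = T
        · rw [h]
        · exact absurd (Pi.single_eq_of_ne h _) hS)
    set g := ρrep ((L.map (sw n)).prod) (Pi.single T 1) with hg
    have hj0 : j < n := by omega
    have h0 : ∀ h2 : IsStandardTableau μ n
        (T.val ∘ Equiv.swap (⟨j, hj0⟩ : Fin n) ⟨j + 1, hj⟩),
        g ⟨T.val ∘ Equiv.swap (⟨j, hj0⟩ : Fin n) ⟨j + 1, hj⟩, h2⟩ = 0 := by
      intro h2
      by_contra h
      have h3 := hs _ h
      have h4 : T.val ⟨j + 1, hj⟩ ∈ T.val '' initSet n j := by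
        rw [← h3]
        exact ⟨⟨j, hj0⟩, by simp [initSet], by simp⟩
      obtain ⟨i, hi, hi'⟩ := h4
      have := T.2.1 hi'
      rw [this] at hi
      simp [initSet] at hi
    simp only [youngOp, LinearMap.coe_mk, AddHom.coe_mk]
    rw [rhoN, dif_pos hj]
    split_ifs with h2
    · rw [h0 h2]; ring
    · ring

lemma trace_prod (hρ : IsYoungOrthogonalRep μ n ρrep) (L : List ℕ) (hnd : L.Nodup)
    (hL : ∀ j ∈ L, j + 1 < n) :
    LinearMap.trace ℂ (YoungSpace μ n) (ρrep ((L.map (sw n)).prod)) =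
      Z L.toFinset n μ 0 := by
  classical
  haveI : Finite {T : Fin n → ℕ × ℕ // IsStandardTableau μ n T} := (syt_finite μ n).to_subtype
  haveI : Fintype {T : Fin n → ℕ × ℕ // IsStandardTableau μ n T} := Fintype.ofFinite _
  rw [← sum_wt, LinearMap.trace_eq_matrix_trace ℂ (Pi.basisFun ℂ _), Matrix.trace]
  rw [Finset.sum_subtype (sytF μ n) (p := fun T => IsStandardTableau μ n T) (fun T => mem_sytF)]
  apply Finset.sum_congr rfl
  intro T _
  rw [wt_eq (by simpa using hL), Matrix.diag_apply, LinearMap.toMatrix_apply, Pi.basisFun_repr,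
    Pi.basisFun_apply, diag_prod hρ L hnd hL, List.prod_toFinset _ hnd]

end trace

lemma prod_fix {n : ℕ} (L : List ℕ) (x : Fin n) (h : ∀ k ∈ L, (x : ℕ) ≠ k ∧ (x : ℕ) ≠ k + 1) :
    (L.map (sw n)).prod x = x := by
  induction L with
  | nil => simp
  | cons k L ih =>
    rw [List.map_cons, List.prod_cons, Equiv.Perm.mul_apply, ih (fun i hi => h i (List.mem_cons_of_mem _ hi)), sw]
    have := h k List.mem_cons_self
    split_ifs with h1
    · apply Equiv.swap_apply_of_ne_of_ne
      · intro e; exact this.1 (congrArg Fin.val e)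
      · intro e; exact this.2 (congrArg Fin.val e)
    · rfl

lemma block_perm (n : ℕ) : ∀ (m N : ℕ) (h : N + m < n),
    (((List.range m).map (fun i => N + i)).map (sw n)).prod =
      (List.ofFn (fun i : Fin (m + 1) => (⟨N + i, by omega⟩ : Fin n))).formPerm := by
  intro m
  induction m with
  | zero => intro N h; simp
  | succ m ih =>
    intro N h
    have e := ih (N + 1) (by omega)
    rw [List.range_succ_eq_map, List.map_cons, List.map_cons, List.prod_cons, List.ofFn_succ, List.ofFn_succ,
      List.formPerm_cons_cons]
    rw [List.ofFn_succ] at e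
    have e1 : ((List.map Nat.succ (List.range m)).map (fun i => N + i)) =
        (List.range m).map (fun i => N + 1 + i) := by
      rw [List.map_map]
      apply List.map_congr_left
      intro i _
      simp; omega
    rw [e1, e, sw, dif_pos (show N + 0 + 1 < n by omega)]
    congr 1
    congr 1
    congr 1
    apply List.ofFn_inj.2 
    ext i
    simp; omega

lemma block_cycleType (n m N : ℕ) (h : N + m < n) :
    (((List.range m).map (fun i => N + i)).map (sw n)).prod.cycleType =
      Multiset.filter (2 ≤ ·) {m + 1} := by
  rw [block_perm n m N h]
  have hnd : (List.ofFn (fun i : Fin (m + 1) => (⟨N + i, by omega⟩ : Fin n))).Nodup := by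
    rw [List.nodup_ofFn]
    intro i j hij
    simp at hij
    exact Fin.ext hij
  cases m with
  | zero => simp [Multiset.filter_singleton]
  | succ m =>
    have hc := List.isCycle_formPerm hnd (by simp)
    rw [hc.cycleType, List.support_formPerm_of_nodup _ hnd, List.toFinset_card_of_nodup hnd]
    · simp [Multiset.filter_singleton]
    · intro x hx
      have := congrArg List.length hx
      simp at this

lemma ks_cycleType (n : ℕ) : ∀ (l : ℕ) (ρ : Fin l → ℕ) (_ : ∀ i, 0 < ρ i) (_ : ∑ i, ρ i ≤ n),
    (((ks l ρ).map (sw n)).prod).cycleType = Multiset.filter (2 ≤ ·) (Finset.univ.val.map ρ) := by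
  intro l
  induction l with
  | zero => intro ρ _ _; simp [ks]
  | succ l ih =>
    intro ρ hp hs
    rw [Fin.sum_univ_castSucc] at hs
    have hlast := hp (Fin.last l)
    have hu : Finset.univ.val.map ρ = {ρ (Fin.last l)} + Finset.univ.val.map (fun i : Fin l => ρ i.castSucc) := by
      rw [Fin.univ_castSuccEmb]
      simp [Finset.map_val, Multiset.map_map, Function.comp_def]
    rw [hu, ks, List.map_append, List.prod_append, Equiv.Perm.Disjoint.cycleType_mul,
      ih _ (fun i => hp _) (by omega), block_cycleType _ _ _ (by omega), Multiset.filter_add, add_comm,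
      Nat.sub_add_cancel hlast]
    intro x
    by_cases hx : (x : ℕ) < ∑ i : Fin l, ρ i.castSucc
    · right
      apply prod_fix
      intro k hk
      simp only [List.mem_map, List.mem_range] at hk
      obtain ⟨i, _, rfl⟩ := hk
      omega
    · left
      apply prod_fix
      intro k hk
      have := ks_lt _ _ k hk
      omega

end MN
open scoped Classical in
/-- **Murnaghan–Nakayama rule.**  Let `μ` be a partition of `n`, let `χ^μ` be the
character of the Young orthogonal form representation `V^μ` of `Sₙ`, and let
`c ∈ Sₙ` have cycle type `ρ = (ρ₁, …, ρ_l)` (as a multiset of cycle lengths, including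
fixed points).  Then `χ^μ(c) = Σ_H (−1)^{L(H)}`, the sum being over all chains of
partitions `∅ = λ(0) ⊆ λ(1) ⊆ ⋯ ⊆ λ(l) = μ` such that each `λ(i)/λ(i−1)` is a skew
hook with `ρ_i` boxes, where `L(H) = Σ_i L(λ(i)/λ(i−1))`. -/
theorem murnaghan_nakayama_rule (n l : ℕ) (μ : YoungDiagram) (hμ : μ.card = n)
    (ρrep : Representation ℂ (Equiv.Perm (Fin n)) (YoungSpace μ n))
    (hρ : IsYoungOrthogonalRep μ n ρrep)
    (c : Equiv.Perm (Fin n)) (ρ : Fin l → ℕ)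
    (hc : Finset.univ.val.map ρ = (Equiv.Perm.partition c).parts) :
    LinearMap.trace ℂ (YoungSpace μ n) (ρrep c) =
      ∑ᶠ H : Fin (l + 1) → YoungDiagram,
        if H 0 = ⊥ ∧ H (Fin.last l) = μ ∧
            (∀ i : Fin l, hookStep (ρ i) (H i.castSucc) (H i.succ)) then
          (-1 : ℂ) ^ (∑ i : Fin l, skewL ((H i.succ).cells \ (H i.castSucc).cells))
        else 0 := by
  classical
  have hpos : ∀ i, 0 < ρ i := by
    intro i
    apply (Equiv.Perm.partition c).parts_pos
    rw [← hc]
    exact Multiset.mem_map_of_mem _ (Finset.mem_univ i)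
  have hsum : ∑ i, ρ i = n := by
    have := (Equiv.Perm.partition c).parts_sum
    rw [← hc] at this
    have h' : (Finset.univ.val.map ρ).sum = ∑ i, ρ i := rfl
    rw [h', Fintype.card_fin] at this
    exact this
  have hct : c.cycleType = (((MN.ks l ρ).map (MN.sw n)).prod).cycleType := by
    rw [MN.ks_cycleType n l ρ hpos hsum.le, hc, Equiv.Perm.parts_partition, Multiset.filter_add,
      Multiset.filter_eq_self.2 (fun x hx => Equiv.Perm.two_le_of_mem_cycleType hx),
      Multiset.filter_eq_nil.2, add_zero]
    intro x hx
    rw [Multiset.eq_of_mem_replicate hx]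
    norm_num
  obtain ⟨g, hg⟩ := isConj_iff.1 (Equiv.Perm.isConj_iff_cycleType_eq.2 hct)
  have htr : LinearMap.trace ℂ (YoungSpace μ n) (ρrep c) =
      LinearMap.trace ℂ (YoungSpace μ n) (ρrep (((MN.ks l ρ).map (MN.sw n)).prod)) := by
    rw [← hg, map_mul, LinearMap.trace_mul_comm, ← map_mul]
    congr 2
    group
  rw [htr, MN.trace_prod hρ _ (MN.ks_nodup l ρ) (fun k hk => hsum ▸ MN.ks_lt l ρ k hk)]
  have h := MN.Z_eq_RR l ρ hpos μ (hμ.trans hsum.symm) 0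
  rw [hsum] at h
  rw [h, MN.RR]
end
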